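/- (Interior Harnack dichotomy) Fix n ≥ 1, Λ ≥ 1, M ≥ 1, and write P±_{Λ,M}(R) := P±(R, 1/(nΛM²), ΛM²). There exist constants C > 0 and c₀ ∈ (0,1), depending only on n, Λ and M, such that the following holds. Let 0 < λ ≤ 1, r > 0, δ ≥ 0, (x₀,t₀) ∈ ℝⁿ×ℝ, and let θ be continuous on C_r^λ(x₀,t₀) := B_r(x₀)×(t₀−λr², t₀+λr²), satisfying in the viscosity sense λθ_t ≤ P⁺_{Λ,M}(D²θ) + δ and λθ_t ≥ P⁻_{Λ,M}(D²θ) − δ in C_r^λ(x₀,t₀). If ϱ ∈ ℝ and μ ≥ Cδr² are such that ϱ ≤ θ ≤ ϱ + μ on C_r^λ(x₀,t₀), then on C_{r/2}^λ(x₀,t₀) := B_{r/2}(x₀)×(t₀−λr²/4, t₀+λr²/4) at least one of the following holds: either ϱ + c₀μ ≤ θ ≤ ϱ + μ, or ϱ ≤ θ ≤ ϱ + (1−c₀)μ. -/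

import Mathlib

open Set MeasureTheory Metric
open scoped RealInnerProductSpace

noncomputable section

abbrev Eucl (n : ℕ) : Type := EuclideanSpace ℝ (Fin n)
abbrev SpaceTime (n : ℕ) : Type := Eucl n × ℝ

/-- The operator norm of an `n × n` real matrix, acting on Euclidean space. -/
noncomputable def matOpNorm {n : ℕ} (A : Matrix (Fin n) (Fin n) ℝ) : ℝ :=
  ‖(LinearMap.toContinuousLinearMap (Matrix.toEuclideanLin A))‖

/-- `F` is uniformly elliptic with ellipticity constant `Λ`. -/
def UniformlyElliptic {n : ℕ} (Λ : ℝ) (F : Matrix (Fin n) (Fin n) ℝ → ℝ) : Prop :=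
  ∀ M N : Matrix (Fin n) (Fin n) ℝ, M.IsSymm → N.IsSymm → N.PosSemidef →
    Λ⁻¹ * matOpNorm N ≤ F (M + N) - F M ∧ F (M + N) - F M ≤ Λ * matOpNorm N

/-- Pucci minimal operator `P⁻(R, a, b) = a ∑_{eᵢ>0} eᵢ + b ∑_{eᵢ<0} eᵢ`. -/
noncomputable def pucciMinus {n : ℕ} (R : Matrix (Fin n) (Fin n) ℝ) (a b : ℝ) : ℝ :=
  if h : R.IsHermitian then
    a * ∑ i, max (h.eigenvalues i) 0 + b * ∑ i, min (h.eigenvalues i) 0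
  else 0

/-- Pucci maximal operator `P⁺(R, a, b) = a ∑_{eᵢ<0} eᵢ + b ∑_{eᵢ>0} eᵢ`. -/
noncomputable def pucciPlus {n : ℕ} (R : Matrix (Fin n) (Fin n) ℝ) (a b : ℝ) : ℝ :=
  if h : R.IsHermitian then
    a * ∑ i, min (h.eigenvalues i) 0 + b * ∑ i, max (h.eigenvalues i) 0
  else 0

/-- Parabolic cylinder `E_ρ(x₀,t₀) = B_ρ(x₀) × (t₀ − ρ², t₀]`. -/
def cylE {n : ℕ} (x₀ : Eucl n) (t₀ ρ : ℝ) : Set (SpaceTime n) :=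
  (ball x₀ ρ) ×ˢ (Ioc (t₀ - ρ ^ 2) t₀)

/-- `φ` is C² in `x` and C¹ in `t` on `D`, with time derivative `φt`,
spatial gradient `gφ` and spatial Hessian `Hφ`. -/
structure ParabolicTest {n : ℕ} (φ : SpaceTime n → ℝ) (D : Set (SpaceTime n))
    (φt : SpaceTime n → ℝ) (gφ : SpaceTime n → Eucl n)
    (Hφ : SpaceTime n → Matrix (Fin n) (Fin n) ℝ) : Prop where
  contPhi : ContinuousOn φ D
  contPhit : ContinuousOn φt D
  contGrad : ContinuousOn gφ D
  contHess : ContinuousOn Hφ D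
  symmHess : ∀ p ∈ D, (Hφ p).IsSymm
  timeDeriv : ∀ p ∈ D, HasDerivWithinAt (fun s : ℝ => φ (p.1, s)) (φt p) {s : ℝ | (p.1, s) ∈ D} p.2
  spaceGrad : ∀ p ∈ D, HasGradientWithinAt (fun y => φ (y, p.2)) (gφ p) {y | (y, p.2) ∈ D} p.1
  spaceHess : ∀ p ∈ D, HasFDerivWithinAt (fun y => gφ (y, p.2))
      (LinearMap.toContinuousLinearMap (Matrix.toEuclideanLin (Hφ p))) {y | (y, p.2) ∈ D} p.1

/-- `φ` touches `u` from above at `p₀` in the set `E`. -/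
def TouchesAbove {n : ℕ} (φ u : SpaceTime n → ℝ) (E : Set (SpaceTime n)) (p₀ : SpaceTime n) :
    Prop :=
  p₀ ∈ E ∧ φ p₀ = u p₀ ∧ ∀ p ∈ E, u p ≤ φ p

/-- `φ` touches `u` from below at `p₀` in the set `E`. -/
def TouchesBelow {n : ℕ} (φ u : SpaceTime n → ℝ) (E : Set (SpaceTime n)) (p₀ : SpaceTime n) :
    Prop :=
  p₀ ∈ E ∧ φ p₀ = u p₀ ∧ ∀ p ∈ E, φ p ≤ u p

/-- `u` is a viscosity subsolution of `u_t = F(D²u)` in `D`. -/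
def ViscSub {n : ℕ} (F : Matrix (Fin n) (Fin n) ℝ → ℝ) (u : SpaceTime n → ℝ)
    (D : Set (SpaceTime n)) : Prop :=
  ∀ (φ φt : SpaceTime n → ℝ) (gφ : SpaceTime n → Eucl n)
    (Hφ : SpaceTime n → Matrix (Fin n) (Fin n) ℝ) (p₀ : SpaceTime n) (ρ : ℝ),
    0 < ρ → p₀ ∈ D → cylE p₀.1 p₀.2 ρ ⊆ D →
    ParabolicTest φ (cylE p₀.1 p₀.2 ρ) φt gφ Hφ →
    TouchesAbove φ u (cylE p₀.1 p₀.2 ρ) p₀ →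
    φt p₀ ≤ F (Hφ p₀)

/-- `u` is a viscosity supersolution of `u_t = F(D²u)` in `D`. -/
def ViscSup {n : ℕ} (F : Matrix (Fin n) (Fin n) ℝ → ℝ) (u : SpaceTime n → ℝ)
    (D : Set (SpaceTime n)) : Prop :=
  ∀ (φ φt : SpaceTime n → ℝ) (gφ : SpaceTime n → Eucl n)
    (Hφ : SpaceTime n → Matrix (Fin n) (Fin n) ℝ) (p₀ : SpaceTime n) (ρ : ℝ),
    0 < ρ → p₀ ∈ D → cylE p₀.1 p₀.2 ρ ⊆ D →
    ParabolicTest φ (cylE p₀.1 p₀.2 ρ) φt gφ Hφ →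
    TouchesBelow φ u (cylE p₀.1 p₀.2 ρ) p₀ →
    F (Hφ p₀) ≤ φt p₀

end

/-- `θ` satisfies `λ θ_t ≤ F(D²θ)` in `D` in the viscosity sense. -/
def ViscSubLam {n : ℕ} (lam : ℝ) (F : Matrix (Fin n) (Fin n) ℝ → ℝ) (u : SpaceTime n → ℝ)
    (D : Set (SpaceTime n)) : Prop :=
  ∀ (φ φt : SpaceTime n → ℝ) (gφ : SpaceTime n → Eucl n)
    (Hφ : SpaceTime n → Matrix (Fin n) (Fin n) ℝ) (p₀ : SpaceTime n) (ρ : ℝ),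
    0 < ρ → p₀ ∈ D → cylE p₀.1 p₀.2 ρ ⊆ D →
    ParabolicTest φ (cylE p₀.1 p₀.2 ρ) φt gφ Hφ →
    TouchesAbove φ u (cylE p₀.1 p₀.2 ρ) p₀ →
    lam * φt p₀ ≤ F (Hφ p₀)

/-- `θ` satisfies `λ θ_t ≥ F(D²θ)` in `D` in the viscosity sense. -/
def ViscSupLam {n : ℕ} (lam : ℝ) (F : Matrix (Fin n) (Fin n) ℝ → ℝ) (u : SpaceTime n → ℝ)
    (D : Set (SpaceTime n)) : Prop :=
  ∀ (φ φt : SpaceTime n → ℝ) (gφ : SpaceTime n → Eucl n)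
    (Hφ : SpaceTime n → Matrix (Fin n) (Fin n) ℝ) (p₀ : SpaceTime n) (ρ : ℝ),
    0 < ρ → p₀ ∈ D → cylE p₀.1 p₀.2 ρ ⊆ D →
    ParabolicTest φ (cylE p₀.1 p₀.2 ρ) φt gφ Hφ →
    TouchesBelow φ u (cylE p₀.1 p₀.2 ρ) p₀ →
    F (Hφ p₀) ≤ lam * φt p₀

/-- The `λ`-scaled cylinder `C_r^λ(x₀,t₀) = B_r(x₀) × (t₀ − λr², t₀ + λr²)`. -/
def cylCLam {n : ℕ} (lam : ℝ) (x₀ : Eucl n) (t₀ r : ℝ) : Set (SpaceTime n) :=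
  ball x₀ r ×ˢ Ioo (t₀ - lam * r ^ 2) (t₀ + lam * r ^ 2)

open Set MeasureTheory Metric
open scoped RealInnerProductSpace


noncomputable def tHess {n : ℕ} (G A : ℝ) (y : Eucl n) : Matrix (Fin n) (Fin n) ℝ :=
  G • (1 : Matrix (Fin n) (Fin n) ℝ) + (8 * A) • Matrix.vecMulVec y.ofLp y.ofLp

lemma tHess_symm {n : ℕ} (G A : ℝ) (y : Eucl n) : (tHess G A y).IsSymm := by
  unfold tHess Matrix.IsSymm
  simp [Matrix.transpose_vecMulVec]

lemma tHess_mulVec {n : ℕ} (G A : ℝ) (y v : Eucl n) :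
    (tHess G A y).mulVec v.ofLp = (G • v + (8 * A * ⟪y, v⟫) • y).ofLp := by
  unfold tHess
  rw [Matrix.add_mulVec, Matrix.smul_mulVec, Matrix.smul_mulVec, Matrix.one_mulVec,
    Matrix.vecMulVec_mulVec]
  ext i
  simp [PiLp.inner_apply, dotProduct]
  have e : ∑ k, y.ofLp k * v.ofLp k = ∑ k, v.ofLp k * y.ofLp k :=
    Finset.sum_congr rfl fun k _ => mul_comm _ _
  rw [e]
  ring

lemma tHess_eig {n : ℕ} (G A : ℝ) (y : Eucl n) (h : (tHess G A y).IsHermitian) (i : Fin n) :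
    h.eigenvalues i = G + 8 * A * ⟪h.eigenvectorBasis i, y⟫ ^ 2 := by
  have h1 := h.mulVec_eigenvectorBasis i
  rw [tHess_mulVec] at h1
  have h2 : G • h.eigenvectorBasis i + (8 * A * ⟪y, h.eigenvectorBasis i⟫) • y
      = h.eigenvalues i • h.eigenvectorBasis i := by
    ext j
    exact congrFun h1 j
  have h3 := congrArg (fun w => ⟪h.eigenvectorBasis i, w⟫) h2
  simp only [inner_add_right, inner_smul_right, real_inner_self_eq_norm_sq,
    OrthonormalBasis.norm_eq_one] at h3
  have hc := real_inner_comm y (h.eigenvectorBasis i)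
  rw [hc] at h3 ⊢
  linear_combination -h3

lemma sum_eig {n : ℕ} (b : OrthonormalBasis (Fin n) ℝ (Eucl n)) (y : Eucl n) :
    ∑ i, ⟪b i, y⟫ ^ 2 = ‖y‖ ^ 2 := by
  have := b.sum_sq_norm_inner_right y
  simpa using this

lemma tHess_pucciMinus {n : ℕ} (G A a b : ℝ) (y : Eucl n) (ha : 0 < a) (hab : a ≤ b)
    (hA : 0 ≤ A) :
    8 * a * A * ‖y‖ ^ 2 - n * b * |G| ≤ pucciMinus (tHess G A y) a b := by
  have h : (tHess G A y).IsHermitian := by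
    rw [Matrix.IsHermitian, Matrix.conjTranspose_eq_transpose_of_trivial]
    exact tHess_symm G A y
  unfold pucciMinus
  rw [dif_pos h, Finset.mul_sum, Finset.mul_sum, ← Finset.sum_add_distrib,
    ← sum_eig h.eigenvectorBasis y, Finset.mul_sum]
  have e : (n : ℝ) * b * |G| = ∑ _i : Fin n, b * |G| := by simp; ring
  rw [e, ← Finset.sum_sub_distrib]
  apply Finset.sum_le_sum
  intro i _
  rw [tHess_eig]
  set q := ⟪h.eigenvectorBasis i, y⟫ ^ 2
  have hq : 0 ≤ A * q := mul_nonneg hA (sq_nonneg _)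
  have := neg_abs_le G
  have h0 := abs_nonneg G
  rcases le_total 0 (G + 8 * A * q) with h1 | h1
  · rw [max_eq_left h1, min_eq_right h1]
    nlinarith
  · rw [max_eq_right h1, min_eq_left h1]
    nlinarith

lemma tHess_pucciPlus {n : ℕ} (G A a b : ℝ) (y : Eucl n) (ha : 0 < a) (hab : a ≤ b)
    (hA : A ≤ 0) :
    pucciPlus (tHess G A y) a b ≤ 8 * a * A * ‖y‖ ^ 2 + n * b * |G| := by
  have h : (tHess G A y).IsHermitian := by
    rw [Matrix.IsHermitian, Matrix.conjTranspose_eq_transpose_of_trivial]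
    exact tHess_symm G A y
  unfold pucciPlus
  rw [dif_pos h, Finset.mul_sum, Finset.mul_sum, ← Finset.sum_add_distrib,
    ← sum_eig h.eigenvectorBasis y, Finset.mul_sum]
  have e : (n : ℝ) * b * |G| = ∑ _i : Fin n, b * |G| := by simp; ring
  rw [e, ← Finset.sum_add_distrib]
  apply Finset.sum_le_sum
  intro i _
  rw [tHess_eig]
  set q := ⟪h.eigenvectorBasis i, y⟫ ^ 2
  have hq : 0 ≤ (-A) * q := mul_nonneg (by linarith) (sq_nonneg _)
  have := le_abs_self G
  have h0 := abs_nonneg G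
  rcases le_total 0 (G + 8 * A * q) with h1 | h1
  · rw [max_eq_left h1, min_eq_right h1]
    nlinarith
  · rw [max_eq_right h1, min_eq_left h1]
    nlinarith

/-- The explicit family of test functions. -/
noncomputable def tfun {n : ℕ} (A B C : ℝ → ℝ) (z p : Eucl n) (x : Eucl n) (t : ℝ) : ℝ :=
  A t * (‖x - z‖ ^ 2) ^ 2 + B t * ‖x - z‖ ^ 2 + ⟪p, x⟫ + C t

lemma tfun_test {n : ℕ} {A B C A' B' C' : ℝ → ℝ} (z p : Eucl n)
    (hA : ∀ t, HasDerivAt A (A' t) t) (hB : ∀ t, HasDerivAt B (B' t) t)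
    (hC : ∀ t, HasDerivAt C (C' t) t)
    (cA : Continuous A') (cB : Continuous B') (cC : Continuous C') (D : Set (SpaceTime n)) :
    ParabolicTest (fun P => tfun A B C z p P.1 P.2) D
      (fun P => A' P.2 * (‖P.1 - z‖ ^ 2) ^ 2 + B' P.2 * ‖P.1 - z‖ ^ 2 + C' P.2)
      (fun P => (4 * A P.2 * ‖P.1 - z‖ ^ 2 + 2 * B P.2) • (P.1 - z) + p)
      (fun P => tHess (4 * A P.2 * ‖P.1 - z‖ ^ 2 + 2 * B P.2) (A P.2) (P.1 - z)) := by
  have kA : Continuous A := continuous_iff_continuousAt.2 fun t => (hA t).continuousAt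
  have kB : Continuous B := continuous_iff_continuousAt.2 fun t => (hB t).continuousAt
  have kC : Continuous C := continuous_iff_continuousAt.2 fun t => (hC t).continuousAt
  have hq : ∀ x : Eucl n, HasFDerivAt (fun x => ‖x - z‖ ^ 2) (2 • (innerSL ℝ) (x - z)) x := by
    intro x
    have h1 := (hasStrictFDerivAt_norm_sq (x - z)).hasFDerivAt
    have h2 : HasFDerivAt (fun x : Eucl n => x - z) (ContinuousLinearMap.id ℝ _) x :=
      (hasFDerivAt_id x).sub_const z
    exact (h1.comp x h2)
  refine ⟨?_, ?_, ?_, ?_, ?_, ?_, ?_, ?_⟩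
  · unfold tfun; fun_prop
  · fun_prop
  · fun_prop
  · apply Continuous.continuousOn
    unfold tHess
    apply continuous_matrix
    intro i j
    simp only [Matrix.add_apply, Matrix.smul_apply, Matrix.vecMulVec_apply]
    fun_prop
  · intro P _; exact tHess_symm _ _ _
  · intro P _
    apply HasDerivAt.hasDerivWithinAt
    have := ((((hA P.2).mul_const ((‖P.1 - z‖ ^ 2) ^ 2)).add
      ((hB P.2).mul_const (‖P.1 - z‖ ^ 2))).add_const ⟪p, P.1⟫).add (hC P.2)
    exact this
  · intro P _
    rw [hasGradientWithinAt_iff_hasFDerivWithinAt]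
    apply HasFDerivAt.hasFDerivWithinAt
    have h1 := hq P.1
    have h2 := ((((h1.pow 2).const_mul (A P.2)).add (h1.const_mul (B P.2))).add
      ((innerSL ℝ p).hasFDerivAt)).add_const (C P.2)
    refine h2.congr_fderiv ?_
    ext v
    simp
    ring
  · intro P _
    apply HasFDerivAt.hasFDerivWithinAt
    have h1 := hq P.1
    have h3 : HasFDerivAt (fun x : Eucl n => x - z) (ContinuousLinearMap.id ℝ _) P.1 :=
      (hasFDerivAt_id P.1).sub_const z
    have h2 := (((h1.const_mul (4 * A P.2)).add_const (2 * B P.2)).smul h3).add_const p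
    refine h2.congr_fderiv ?_
    ext v i
    simp only [LinearMap.coe_toContinuousLinearMap']
    rw [Matrix.toLpLin_apply, tHess_mulVec]
    simp [inner_sub_left]
    ring_nf
    simp


/-- supersolutions, tested against the explicit family only. -/
def SupT {n : ℕ} (a nb lam f : ℝ) (u : SpaceTime n → ℝ) (D : Set (SpaceTime n)) : Prop :=
  ∀ (A B C A' B' C' : ℝ → ℝ) (z p x0 : Eucl n) (t0 ε : ℝ),
    (∀ t, HasDerivAt A (A' t) t) → (∀ t, HasDerivAt B (B' t) t) →
    (∀ t, HasDerivAt C (C' t) t) → Continuous A' → Continuous B' → Continuous C' →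
    0 < ε → (x0, t0) ∈ D → 0 ≤ A t0 →
    tfun A B C z p x0 t0 = u (x0, t0) →
    (∀ x t, ‖x - x0‖ < ε → t0 - ε < t → t ≤ t0 → tfun A B C z p x t ≤ u (x, t)) →
    8 * a * A t0 * ‖x0 - z‖ ^ 2 - nb * |4 * A t0 * ‖x0 - z‖ ^ 2 + 2 * B t0| - f ≤
      lam * (A' t0 * (‖x0 - z‖ ^ 2) ^ 2 + B' t0 * ‖x0 - z‖ ^ 2 + C' t0)

lemma exists_cyl {n : ℕ} {D : Set (SpaceTime n)} (hD : IsOpen D) {x0 : Eucl n} {t0 ε : ℝ}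
    (hε : 0 < ε) (h : (x0, t0) ∈ D) :
    ∃ ρ : ℝ, 0 < ρ ∧ cylE x0 t0 ρ ⊆ D ∧
      ∀ P ∈ cylE x0 t0 ρ, ‖P.1 - x0‖ < ε ∧ t0 - ε < P.2 ∧ P.2 ≤ t0 := by
  obtain ⟨η, hη, hb⟩ := Metric.isOpen_iff.1 hD _ h
  refine ⟨min 1 (min η ε), by positivity, ?_, ?_⟩
  · rintro ⟨x, t⟩ ⟨h1, h2⟩
    apply hb
    simp only [mem_ball, mem_Ioc] at h1 h2
    rw [mem_ball, Prod.dist_eq, max_lt_iff]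
    have k1 : min 1 (min η ε) ≤ η := (min_le_right _ _).trans (min_le_left _ _)
    have k2 : min 1 (min η ε) ≤ 1 := min_le_left _ _
    have k3 : 0 < min 1 (min η ε) := by positivity
    refine ⟨lt_of_lt_of_le h1 k1, ?_⟩
    simp only [Real.dist_eq]
    rw [abs_lt]
    constructor <;> nlinarith
  · rintro ⟨x, t⟩ ⟨h1, h2⟩
    simp only [mem_ball, mem_Ioc] at h1 h2
    have k1 : min 1 (min η ε) ≤ ε := (min_le_right _ _).trans (min_le_right _ _)
    have k2 : min 1 (min η ε) ≤ 1 := min_le_left _ _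
    have k3 : 0 < min 1 (min η ε) := by positivity
    rw [dist_eq_norm] at h1
    refine ⟨lt_of_lt_of_le h1 k1, ?_, h2.2⟩
    simp only
    nlinarith

lemma SupT_of_visc {n : ℕ} {a b lam δ : ℝ} (ha : 0 < a) (hab : a ≤ b) {θ : SpaceTime n → ℝ}
    {D : Set (SpaceTime n)} (hD : IsOpen D)
    (h : ViscSupLam lam (fun H => pucciMinus H a b - δ) θ D) :
    SupT a (n * b) lam δ θ D := by
  intro A B C A' B' C' z p x0 t0 ε hA hB hC cA cB cC hε hm hA0 he ht
  obtain ⟨ρ, hρ, hs, hcl⟩ := exists_cyl hD hε hm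
  have := h _ _ _ _ (x0, t0) ρ hρ hm hs (tfun_test z p hA hB hC cA cB cC _)
    ⟨⟨mem_ball_self hρ, by simp; positivity⟩, he, fun P hP => by
      obtain ⟨h1, h2, h3⟩ := hcl P hP
      exact ht _ _ h1 h2 h3⟩
  have h2 := tHess_pucciMinus (4 * A t0 * ‖x0 - z‖ ^ 2 + 2 * B t0) (A t0) a b (x0 - z) ha hab hA0
  simp only at this
  linarith

lemma SupT_of_visc_neg {n : ℕ} {a b lam δ : ℝ} (ha : 0 < a) (hab : a ≤ b) {θ : SpaceTime n → ℝ}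
    {D : Set (SpaceTime n)} (hD : IsOpen D)
    (h : ViscSubLam lam (fun H => pucciPlus H a b + δ) θ D) :
    SupT a (n * b) lam δ (fun P => - θ P) D := by
  intro A B C A' B' C' z p x0 t0 ε hA hB hC cA cB cC hε hm hA0 he ht
  obtain ⟨ρ, hρ, hs, hcl⟩ := exists_cyl hD hε hm
  have key : ∀ x t, tfun (fun t => - A t) (fun t => - B t) (fun t => - C t) z (-p) x t
      = - tfun A B C z p x t := by
    intro x t; unfold tfun; rw [inner_neg_left]; ring
  have := h _ _ _ _ (x0, t0) ρ hρ hm hs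
    (tfun_test z (-p) (fun t => (hA t).neg) (fun t => (hB t).neg) (fun t => (hC t).neg)
      cA.neg cB.neg cC.neg _)
    ⟨⟨mem_ball_self hρ, by simp; positivity⟩, by
        simp only
        have := key x0 t0
        erw [this]; rw [he]; simp, fun P hP => by
      obtain ⟨h1, h2, h3⟩ := hcl P hP
      have h4 := ht _ _ h1 h2 h3
      have := key P.1 P.2
      simp only
      erw [this]
      simp only [Prod.mk.eta] at h4
      linarith⟩
  simp only [Pi.neg_apply] at this
  have h2 := tHess_pucciPlus (4 * (-A t0) * ‖x0 - z‖ ^ 2 + 2 * (-B t0)) (-A t0) a b (x0 - z) ha hab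
    (by linarith)
  have h3 : |4 * (-A t0) * ‖x0 - z‖ ^ 2 + 2 * (-B t0)| = |4 * A t0 * ‖x0 - z‖ ^ 2 + 2 * B t0| := by
    rw [← abs_neg]; congr 1; ring
  rw [h3] at h2
  linarith

lemma SupT.scale {n : ℕ} {a nb lam f : ℝ} {θ : SpaceTime n → ℝ} {D : Set (SpaceTime n)}
    (h : SupT a nb lam f θ D) (x1 : Eucl n) (t1 c : ℝ) {r μ : ℝ} (hlam : 0 < lam) (hr : 0 < r)
    (hμ : 0 < μ) :
    SupT a nb 1 (f * r ^ 2 / μ)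
      (fun P => (θ (x1 + r • P.1, t1 + lam * r ^ 2 * P.2) - c) / μ)
      ((fun P : SpaceTime n => (x1 + r • P.1, t1 + lam * r ^ 2 * P.2)) ⁻¹' D) := by
  intro A B C A' B' C' z p x0 t0 ε hA hB hC cA cB cC hε hm hA0 he ht
  have hl : 0 < lam * r ^ 2 := by positivity
  set k := lam * r ^ 2 with hk
  have hτ : ∀ T, HasDerivAt (fun T => (T - t1) / k) (1 / k) T := fun T =>
    ((hasDerivAt_id T).sub_const t1).div_const k
  have key : ∀ X T, tfun (fun T => μ / r ^ 4 * A ((T - t1) / k)) (fun T => μ / r ^ 2 * B ((T - t1) / k))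
      (fun T => μ * C ((T - t1) / k) + (c - μ / r * ⟪p, x1⟫)) (x1 + r • z) ((μ / r) • p) X T
      = μ * tfun A B C z p (r⁻¹ • (X - x1)) ((T - t1) / k) + c := by
    intro X T
    have e1 : X - (x1 + r • z) = r • (r⁻¹ • (X - x1) - z) := by
      rw [smul_sub, smul_inv_smul₀ hr.ne']; abel
    unfold tfun
    rw [e1, norm_smul, Real.norm_of_nonneg hr.le, inner_smul_left, inner_smul_right, inner_sub_right]
    simp only [conj_trivial]
    field_simp
    ring
  have ex : r⁻¹ • (x1 + r • x0 - x1) = x0 := by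
    rw [add_sub_cancel_left, inv_smul_smul₀ hr.ne']
  have et : (t1 + k * t0 - t1) / k = t0 := by field_simp; ring
  have key0 := key (x1 + r • x0) (t1 + k * t0)
  rw [ex, et, he] at key0
  have e2 : x1 + r • x0 - (x1 + r • z) = r • (x0 - z) := by rw [smul_sub]; abel
  have := h _ _ _ _ _ _ (x1 + r • z) ((μ / r) • p) (x1 + r • x0) (t1 + k * t0) (min (r * ε) (k * ε))
    (fun T => ((hA _).comp T (hτ T)).const_mul (μ / r ^ 4))
    (fun T => ((hB _).comp T (hτ T)).const_mul (μ / r ^ 2))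
    (fun T => (((hC _).comp T (hτ T)).const_mul μ).add_const (c - μ / r * ⟪p, x1⟫))
    (by fun_prop) (by fun_prop) (by fun_prop)
    (by positivity) hm
    (by simp only [Function.comp, et]; positivity)
    (by
      erw [key0]; field_simp; ring)
    (by
      intro x t h1 h2 h3
      erw [key x t]
      have h4 := ht (r⁻¹ • (x - x1)) ((t - t1) / k)
        (by
          have : r⁻¹ • (x - x1) - x0 = r⁻¹ • (x - (x1 + r • x0)) := by
            rw [← sub_sub, smul_sub r⁻¹ (x - x1), inv_smul_smul₀ hr.ne']
          rw [this, norm_smul, norm_inv, Real.norm_of_nonneg hr.le, inv_mul_lt_iff₀ hr]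
          exact h1.trans_le (min_le_left _ _))
        (by
          rw [lt_div_iff₀ hl]
          have := min_le_right (r * ε) (k * ε)
          nlinarith)
        (by rw [div_le_iff₀ hl]; linarith)
      simp only at h4
      rw [smul_inv_smul₀ hr.ne', mul_div_cancel₀ _ hl.ne'] at h4
      simp only [add_sub_cancel] at h4
      rw [le_div_iff₀ hμ] at h4
      linarith)
  simp only [Function.comp, et, e2, norm_smul, Real.norm_of_nonneg hr.le] at this
  have e3 : |4 * (μ / r ^ 4 * A t0) * (r * ‖x0 - z‖) ^ 2 + 2 * (μ / r ^ 2 * B t0)|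
      = μ / r ^ 2 * |4 * A t0 * ‖x0 - z‖ ^ 2 + 2 * B t0| := by
    rw [← abs_of_pos (show 0 < μ / r ^ 2 by positivity), ← abs_mul, abs_of_pos (show 0 < μ / r ^ 2 by positivity)]
    congr 1
    field_simp
  rw [e3] at this
  have hmul := mul_le_mul_of_nonneg_left this (show 0 ≤ r ^ 2 / μ by positivity)
  have e4 : r ^ 2 / μ * (8 * a * (μ / r ^ 4 * A t0) * (r * ‖x0 - z‖) ^ 2 -
      nb * (μ / r ^ 2 * |4 * A t0 * ‖x0 - z‖ ^ 2 + 2 * B t0|) - f) =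
      8 * a * A t0 * ‖x0 - z‖ ^ 2 - nb * |4 * A t0 * ‖x0 - z‖ ^ 2 + 2 * B t0| - f * r ^ 2 / μ := by
    field_simp
  rw [e4] at hmul
  refine hmul.trans (le_of_eq ?_)
  rw [hk]
  field_simp

lemma SupT.add {n : ℕ} {a nb f : ℝ} {u : SpaceTime n → ℝ} {D : Set (SpaceTime n)}
    (h : SupT a nb 1 f u D) (hnb : 0 ≤ nb) (k : ℝ) (hk : 0 ≤ k) (p' : Eucl n) (H : ℝ) :
    SupT a nb 1 (f + 2 * nb * k + k)
      (fun P => u P + k * ‖P.1‖ ^ 2 - k * P.2 - (⟪p', P.1⟫ + H)) D := by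
  intro A B C A' B' C' z p x0 t0 ε hA hB hC cA cB cC hε hm hA0 he ht
  have key : ∀ x t, tfun A (fun t => B t - k) (fun t => C t + k * t + (k * ‖z‖ ^ 2 + H)) z
      (p + p' - (2 * k) • z) x t
      = tfun A B C z p x t - k * ‖x‖ ^ 2 + k * t + (⟪p', x⟫ + H) := by
    intro x t
    unfold tfun
    have : ‖x‖ ^ 2 = ‖x - z‖ ^ 2 + 2 * ⟪z, x⟫ - ‖z‖ ^ 2 := by
      rw [norm_sub_sq_real, real_inner_comm]; ring
    rw [this, inner_sub_left, inner_add_left, inner_smul_left]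
    simp only [conj_trivial]
    ring
  have := h A (fun t => B t - k) (fun t => C t + k * t + (k * ‖z‖ ^ 2 + H)) A' B'
    (fun t => C' t + k * 1) z (p + p' - (2 * k) • z) x0 t0 ε hA (fun t => (hB t).sub_const k)
    (fun t => ((hC t).add ((hasDerivAt_id t).const_mul k)).add_const _) cA cB (by fun_prop) hε hm hA0
    (by rw [key, he]; simp only; ring)
    (by
      intro x t h1 h2 h3
      have := ht x t h1 h2 h3
      rw [key]
      simp only at this
      linarith)
  have h2 : |4 * A t0 * ‖x0 - z‖ ^ 2 + 2 * (B t0 - k)| ≤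
      |4 * A t0 * ‖x0 - z‖ ^ 2 + 2 * B t0| + 2 * k := by
    have e : 4 * A t0 * ‖x0 - z‖ ^ 2 + 2 * (B t0 - k) =
      (4 * A t0 * ‖x0 - z‖ ^ 2 + 2 * B t0) + (-(2 * k)) := by ring
    rw [e]
    refine (abs_add_le _ _).trans ?_
    rw [abs_neg, abs_of_nonneg (show 0 ≤ 2 * k by positivity)]
  have h3 := mul_le_mul_of_nonneg_left h2 hnb
  nlinarith


noncomputable def alph (a nb κ : ℝ) : ℝ := (2 * κ + 4 * nb + 8 * a) ^ 2 / (32 * a)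

lemma alph_nonneg {a nb κ : ℝ} (ha : 0 < a) : 0 ≤ alph a nb κ := by
  unfold alph; positivity

lemma alph_key {a nb κ : ℝ} (ha : 0 < a) (X : ℝ) :
    -(alph a nb κ) * X ^ 2 + (2 * κ + 4 * nb + 8 * a) * X - 8 * a ≤ 0 := by
  have : -(alph a nb κ) * X ^ 2 + (2 * κ + 4 * nb + 8 * a) * X - 8 * a =
      -(((2 * κ + 4 * nb + 8 * a) * X - 16 * a) ^ 2 / (32 * a)) := by
    unfold alph; field_simp; ring
  rw [this]
  have : 0 ≤ ((2 * κ + 4 * nb + 8 * a) * X - 16 * a) ^ 2 / (32 * a) := by positivity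
  linarith

set_option maxHeartbeats 800000 in
lemma spread {n : ℕ} {a nb f : ℝ} {u : SpaceTime n → ℝ} {D : Set (SpaceTime n)}
    (h : SupT a nb 1 f u D) (hc : ContinuousOn u D) (ha : 0 < a) (hf : 0 ≤ f)
    {z : Eucl n} {s ρ κ T m : ℝ} (hρ : 0 < ρ) (hκ : 0 ≤ κ) (hm0 : 0 ≤ m)
    (hK : ∀ x t, s ≤ t → t ≤ s + T → ‖x - z‖ ^ 2 ≤ ρ ^ 2 + κ * (t - s) → (x, t) ∈ D ∧ 0 ≤ u (x, t))
    (hm : ∀ x, ‖x - z‖ ≤ ρ → m ≤ u (x, s)) :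
    ∀ x t, s ≤ t → t ≤ s + T → ‖x - z‖ ^ 2 ≤ ρ ^ 2 + κ * (t - s) →
      m * Real.exp (-(alph a nb κ / ρ ^ 2 * (t - s))) *
        ((ρ ^ 2 + κ * (t - s) - ‖x - z‖ ^ 2) / ρ ^ 2) ^ 2 - f * (t - s) ≤ u (x, t) := by
  intro x' t' h1' h2' h3'
  by_contra hcon
  push Not at hcon
  set α := alph a nb κ / ρ ^ 2 with hα
  set ψ : SpaceTime n → ℝ := fun P => m * Real.exp (-(α * (P.2 - s))) *
        ((ρ ^ 2 + κ * (P.2 - s) - ‖P.1 - z‖ ^ 2) / ρ ^ 2) ^ 2 with hψ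
  obtain ⟨η, hη, hη2⟩ : ∃ η : ℝ, 0 < η ∧ u (x', t') < ψ (x', t') - (f + η) * (t' - s) := by
    set g := ψ (x', t') - f * (t' - s) - u (x', t') with hg
    have hg0 : 0 < g := by rw [hg]; simp only [hψ]; linarith
    have hτ : 0 ≤ t' - s := by linarith
    refine ⟨g / (2 * (t' - s + 1)), by positivity, ?_⟩
    have : g / (2 * (t' - s + 1)) * (t' - s) < g := by
      rw [div_mul_eq_mul_div, div_lt_iff₀ (by positivity)]
      nlinarith
    linarith
  set K : Set (SpaceTime n) := {P | s ≤ P.2 ∧ P.2 ≤ s + T ∧ ‖P.1 - z‖ ^ 2 ≤ ρ ^ 2 + κ * (P.2 - s)}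
    with hKdef
  have hKD : K ⊆ D := fun P hP => (hK P.1 P.2 hP.1 hP.2.1 hP.2.2).1
  have hKcl : IsClosed K := by
    simp only [hKdef, ofPred_and]
    refine IsClosed.inter (isClosed_le (by fun_prop) (by fun_prop)) (IsClosed.inter
      (isClosed_le (by fun_prop) (by fun_prop)) (isClosed_le (by fun_prop) (by fun_prop)))
  have hKc : IsCompact K := by
    apply ((isCompact_closedBall z (Real.sqrt (ρ ^ 2 + κ * T))).prod
      (isCompact_Icc (a := s) (b := s + T))).of_isClosed_subset hKcl
    rintro ⟨x, t⟩ ⟨h1, h2, h3⟩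
    simp only at h1 h2 h3
    refine ⟨?_, h1, h2⟩
    simp only [mem_closedBall, dist_eq_norm]
    apply Real.le_sqrt_of_sq_le
    nlinarith
  have hψc : Continuous ψ := by
    rw [hψ]
    fun_prop
  obtain ⟨⟨x0, t0⟩, hP0, hmin⟩ := hKc.exists_isMinOn ⟨(x', t'), h1', h2', h3'⟩
    (f := fun P => u P - (ψ P - (f + η) * (P.2 - s)))
    ((hc.mono hKD).sub (by fun_prop))
  have hle : ∀ P ∈ K, u (x0, t0) - (ψ (x0, t0) - (f + η) * (t0 - s)) ≤
      u P - (ψ P - (f + η) * (P.2 - s)) := fun P hP => hmin hP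
  have hneg := hle (x', t') ⟨h1', h2', h3'⟩
  simp only at hneg
  obtain ⟨k1, k2, k3⟩ := hP0
  simp only at k1 k2 k3
  set v0 := u (x0, t0) - (ψ (x0, t0) - (f + η) * (t0 - s)) with hv0
  have hv0neg : v0 < 0 := by linarith
  have hu0 : 0 ≤ u (x0, t0) := (hK x0 t0 k1 k2 k3).2
  -- strict interior in time
  have hts : s < t0 := by
    rcases k1.lt_or_eq with h | h
    · exact h
    · exfalso
      subst h
      have h5 : ψ (x0, s) ≤ m := by
        simp only [hψ, sub_self, mul_zero, neg_zero, Real.exp_zero, mul_one, add_zero] at k3 ⊢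
        have : ((ρ ^ 2 - ‖x0 - z‖ ^ 2) / ρ ^ 2) ^ 2 ≤ 1 := by
          apply pow_le_one₀
          · apply div_nonneg <;> nlinarith
          · rw [div_le_one (by positivity)]; nlinarith [sq_nonneg ‖x0 - z‖]
        nlinarith
      have h6 := hm x0 (by
        simp only [sub_self, mul_zero, add_zero] at k3
        exact abs_le_of_sq_le_sq' k3 hρ.le |>.2)
      simp only [sub_self, mul_zero] at hv0
      linarith
  have hw : ‖x0 - z‖ ^ 2 < ρ ^ 2 + κ * (t0 - s) := by
    rcases k3.lt_or_eq with h | h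
    · exact h
    · exfalso
      have : ψ (x0, t0) = 0 := by
        simp only [hψ, h]; simp
      have : 0 ≤ (f + η) * (t0 - s) := mul_nonneg (by linarith) (by linarith)
      linarith
  have hop : IsOpen {P : SpaceTime n | s < P.2 ∧ ‖P.1 - z‖ ^ 2 < ρ ^ 2 + κ * (P.2 - s)} := by
    simp only [ofPred_and]
    exact (isOpen_lt (by fun_prop) (by fun_prop)).inter (isOpen_lt (by fun_prop) (by fun_prop))
  obtain ⟨ε, hε, hb⟩ := Metric.isOpen_iff.1 hop (x0, t0) ⟨hts, hw⟩
  set A : ℝ → ℝ := fun t => m / ρ ^ 4 * Real.exp (-(α * (t - s))) with hAdef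
  have dR : ∀ t, HasDerivAt (fun t => ρ ^ 2 + κ * (t - s)) κ t := fun t => by
    have := (((hasDerivAt_id t).sub_const s).const_mul κ).const_add (ρ ^ 2)
    simpa using this
  have dA : ∀ t, HasDerivAt A (-α * A t) t := fun t => by
    have h0 : HasDerivAt (fun t => -(α * (t - s))) (-α) t := by
      have := (((hasDerivAt_id t).sub_const s).const_mul α).fun_neg
      simpa using this
    have := (h0.exp).const_mul (m / ρ ^ 4)
    refine this.congr_deriv ?_
    simp only [hAdef]; ring
  have dL : ∀ t, HasDerivAt (fun t => (f + η) * (t - s)) (f + η) t := fun t => by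
    have := ((hasDerivAt_id t).sub_const s).const_mul (f + η)
    simpa using this
  have cA : Continuous A := by rw [hAdef]; fun_prop
  have dB : ∀ t, HasDerivAt (fun t => -2 * (A t * (ρ ^ 2 + κ * (t - s))))
      (-2 * (-α * A t * (ρ ^ 2 + κ * (t - s)) + A t * κ)) t := fun t =>
    ((dA t).mul (dR t)).const_mul (-2)
  have dC : ∀ t, HasDerivAt (fun t => A t * (ρ ^ 2 + κ * (t - s)) ^ 2 - (f + η) * (t - s) + v0)
      (-α * A t * (ρ ^ 2 + κ * (t - s)) ^ 2 + A t * (2 * (ρ ^ 2 + κ * (t - s)) * κ) - (f + η)) t :=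
    fun t => by
    have := (((dA t).mul ((dR t).pow 2)).sub (dL t)).add_const v0
    refine this.congr_deriv ?_
    simp
  have key : ∀ x t, tfun A (fun t => -2 * (A t * (ρ ^ 2 + κ * (t - s))))
      (fun t => A t * (ρ ^ 2 + κ * (t - s)) ^ 2 - (f + η) * (t - s) + v0) z 0 x t =
      ψ (x, t) - (f + η) * (t - s) + v0 := by
    intro x t
    unfold tfun
    simp only [hψ, hAdef, inner_zero_left]
    field_simp
    ring
  have hA0 : 0 ≤ A t0 := by rw [hAdef]; positivity
  have := h _ _ _ _ _ _ z 0 x0 t0 ε dA dB dC (by fun_prop) (by fun_prop) (by fun_prop) hε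
    (hKD ⟨k1, k2, k3⟩) hA0 (by rw [key, hv0]; ring) (by
      intro x t h1 h2 h3
      rw [key]
      have hmem : (x, t) ∈ ball ((x0, t0) : SpaceTime n) ε := by
        rw [mem_ball, Prod.dist_eq, max_lt_iff, dist_eq_norm, Real.dist_eq, abs_lt]
        refine ⟨h1, ?_, ?_⟩ <;> simp only <;> linarith
      obtain ⟨h4, h5⟩ := hb hmem
      have := hle (x, t) ⟨h4.le, h3.trans k2, h5.le⟩
      simp only at this
      linarith)
  set q := ‖x0 - z‖ ^ 2 with hq
  set R := ρ ^ 2 + κ * (t0 - s) with hR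
  have hG : |4 * A t0 * q + 2 * (-2 * (A t0 * R))| = 4 * (A t0 * (R - q)) := by
    have : 4 * A t0 * q + 2 * (-2 * (A t0 * R)) = - (4 * (A t0 * (R - q))) := by ring
    rw [this, abs_neg, abs_of_nonneg]
    have : 0 ≤ A t0 * (R - q) := mul_nonneg hA0 (by linarith)
    linarith
  rw [hG] at this
  have hkey := alph_key (a := a) (nb := nb) (κ := κ) ha ((R - q) / ρ ^ 2)
  have hk2 := mul_le_mul_of_nonneg_left hkey (show 0 ≤ A t0 * ρ ^ 2 by positivity)
  have e : A t0 * ρ ^ 2 * (-(alph a nb κ) * ((R - q) / ρ ^ 2) ^ 2 +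
      (2 * κ + 4 * nb + 8 * a) * ((R - q) / ρ ^ 2) - 8 * a) =
      A t0 * (-α * (R - q) ^ 2 + (2 * κ + 4 * nb + 8 * a) * (R - q) - 8 * a * ρ ^ 2) := by
    rw [hα]; field_simp
  rw [e] at hk2
  have hRρ : ρ ^ 2 ≤ R := le_add_of_nonneg_right (mul_nonneg hκ (by linarith))
  have h9 : A t0 * (8 * a) * ρ ^ 2 ≤ A t0 * (8 * a) * R := by gcongr
  clear_value A q R ψ α
  linarith


def Contact {n : ℕ} (v : SpaceTime n → ℝ) (p : Eucl n) (H : ℝ) (x : Eucl n) (t : ℝ) : Prop :=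
  ‖x‖ ≤ 9 / 10 ∧ -3 / 4 ≤ t ∧ t ≤ 0 ∧ v (x, t) = ⟪p, x⟫ + H ∧
    ∀ y s, ‖y‖ ≤ 1 → -1 ≤ s → s ≤ t → ⟪p, y⟫ + H ≤ v (y, s)

lemma contact_close {n : ℕ} {a nb f : ℝ} {v : SpaceTime n → ℝ} {D : Set (SpaceTime n)}
    (ha : 0 < a) (hf : 0 ≤ f) (hc : ContinuousOn v D)
    (hD : ∀ x t, ‖x‖ ≤ 1 → -1 ≤ t → t ≤ 0 → (x, t) ∈ D)
    (hv : ∀ p H, SupT a nb 1 f (fun P => v P - (⟪p, P.1⟫ + H)) D)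
    {p0 p1 x0 x1 : Eucl n} {H0 H1 t0 t1 h : ℝ} (c0 : Contact v p0 H0 x0 t0)
    (c1 : Contact v p1 H1 x1 t1) (ht : t1 ≤ t0) (hh : 0 < h) (hh1 : h ≤ 1 / 100)
    (hx : ‖x1 - x0‖ ≤ h) (htt : t0 - t1 ≤ h ^ 2) :
    0 ≤ ⟪p1 - p0, x1⟫ + (H1 - H0) ∧
    ⟪p1 - p0, x1⟫ + (H1 - H0) + h * ‖p1 - p0‖ ≤
      2 * f * Real.exp (2 * alph a nb 15) * h ^ 2 := by
  obtain ⟨a1, a2, a3, a4, a5⟩ := c0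
  obtain ⟨b1, b2, b3, b4, b5⟩ := c1
  set p := p1 - p0 with hp
  set d := ⟪p, x1⟫ + (H1 - H0) with hd
  have hd0 : 0 ≤ d := by
    have := a5 x1 t1 (by linarith) (by linarith) ht
    rw [hd, hp, inner_sub_left]; linarith
  refine ⟨hd0, ?_⟩
  obtain ⟨e, he1, he2⟩ : ∃ e : Eucl n, ‖e‖ ≤ 1 ∧ ⟪p, e⟫ = ‖p‖ := by
    by_cases h0 : p = 0
    · exact ⟨0, by simp, by simp [h0]⟩
    · have : ‖p‖ ≠ 0 := norm_ne_zero_iff.2 h0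
      refine ⟨‖p‖⁻¹ • p, ?_, ?_⟩
      · rw [norm_smul, norm_inv, norm_norm, inv_mul_cancel₀ this]
      · rw [inner_smul_right, real_inner_self_eq_norm_sq]; field_simp
  set z := x1 + (2 * h) • e with hz
  have hzx : ‖z - x1‖ ≤ 2 * h := by
    rw [hz, add_sub_cancel_left, norm_smul, Real.norm_of_nonneg (by positivity)]
    nlinarith
  have hh2 : h ^ 2 ≤ 1 / 10000 := by nlinarith
  have hfar : ∀ x, ‖x - z‖ ≤ 6 * h → ‖x‖ ≤ 1 := by
    intro x hx
    have e1 : x = (x - z) + (z - x1) + x1 := by abel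
    have := norm_add₃_le (a := x - z) (b := z - x1) (c := x1)
    rw [← e1] at this
    linarith
  have hm0 : 0 ≤ d + h * ‖p‖ := by positivity
  have hgc : ContinuousOn (fun P : SpaceTime n => v P - (⟪p0, P.1⟫ + H0)) D :=
    hc.sub (by fun_prop)
  have key := spread (hv p0 H0) hgc ha hf (z := z) (s := t1 - h ^ 2) (ρ := h) (κ := 15)
    (T := t0 - (t1 - h ^ 2)) (m := d + h * ‖p‖) hh (by norm_num) hm0
    (by
      intro x t h1 h2 h3
      have hx6 : ‖x - z‖ ≤ 6 * h := by
        apply abs_le_of_sq_le_sq' _ (by positivity) |>.2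
        nlinarith
      refine ⟨hD x t (hfar x hx6) (by linarith) (by linarith), ?_⟩
      have := a5 x t (hfar x hx6) (by linarith) (by linarith)
      simp only
      linarith)
    (by
      intro x hxz
      have := b5 x (t1 - h ^ 2) (hfar x (by linarith)) (by linarith) (by nlinarith)
      simp only
      have e1 : ⟪p1, x⟫ = ⟪p0, x⟫ + ⟪p, x⟫ := by rw [hp, inner_sub_left]; ring
      have e2 : ⟪p, x⟫ = ⟪p, x - z⟫ + ⟪p, x1⟫ + 2 * h * ‖p‖ := by
        rw [← he2, ← inner_smul_right, ← inner_add_right, ← inner_add_right]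
        congr 1
        rw [hz]; abel
      have e3 : -(h * ‖p‖) ≤ ⟪p, x - z⟫ := by
        have h5 := abs_real_inner_le_norm p (x - z)
        have h6 := neg_abs_le ⟪p, x - z⟫
        have h7 : ‖p‖ * ‖x - z‖ ≤ ‖p‖ * h := by gcongr
        linarith
      linarith)
    x0 t0 (by nlinarith) (by linarith)
  have hx0z : ‖x0 - z‖ ≤ 3 * h := by
    have e1 : x0 - z = -(x1 - x0) - (z - x1) := by abel
    rw [e1]
    refine (norm_sub_le _ _).trans ?_
    rw [norm_neg]; linarith
  have hx0z2 : ‖x0 - z‖ ^ 2 ≤ 9 * h ^ 2 := by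
    have := pow_le_pow_left₀ (norm_nonneg _) hx0z 2
    linarith
  have hh0 : 0 < h ^ 2 := by positivity
  have key2 := key (by nlinarith)
  simp only [a4, sub_self] at key2
  have hα := alph_nonneg (nb := nb) (κ := 15) ha
  set τ := t0 - (t1 - h ^ 2) with hτ
  have hτ1 : h ^ 2 ≤ τ := by rw [hτ]; linarith
  have hτ2 : τ ≤ 2 * h ^ 2 := by rw [hτ]; linarith
  have hE : Real.exp (-(2 * alph a nb 15)) ≤ Real.exp (-(alph a nb 15 / h ^ 2 * τ)) := by
    apply Real.exp_le_exp.2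
    have : alph a nb 15 / h ^ 2 * τ ≤ alph a nb 15 / h ^ 2 * (2 * h ^ 2) := by gcongr
    have e1 : alph a nb 15 / h ^ 2 * (2 * h ^ 2) = 2 * alph a nb 15 := by field_simp
    linarith
  have hW : 1 ≤ ((h ^ 2 + 15 * τ - ‖x0 - z‖ ^ 2) / h ^ 2) ^ 2 := by
    apply one_le_pow₀
    rw [one_le_div hh0]
    linarith
  have h8 : (d + h * ‖p‖) * Real.exp (-(2 * alph a nb 15)) ≤
      (d + h * ‖p‖) * Real.exp (-(alph a nb 15 / h ^ 2 * τ)) *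
        ((h ^ 2 + 15 * τ - ‖x0 - z‖ ^ 2) / h ^ 2) ^ 2 := by
    calc _ ≤ (d + h * ‖p‖) * Real.exp (-(alph a nb 15 / h ^ 2 * τ)) := by gcongr
      _ ≤ _ := le_mul_of_one_le_right (by positivity) hW
  have h9 : (d + h * ‖p‖) * Real.exp (-(2 * alph a nb 15)) ≤ 2 * f * h ^ 2 := by
    have : f * τ ≤ f * (2 * h ^ 2) := by gcongr
    linarith
  rw [Real.exp_neg, ← div_eq_mul_inv, div_le_iff₀ (Real.exp_pos _)] at h9
  linarith

/-- existence of contact points -/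
lemma exists_contact {n : ℕ} {v : SpaceTime n → ℝ}
    (hc : ContinuousOn v (closedBall 0 1 ×ˢ Icc (-1) 0))
    (hv : ∀ x t, ‖x‖ ≤ 1 → -1 ≤ t → t ≤ 0 → 4 * ‖x‖ ^ 2 - 4 * t ≤ v (x, t))
    (hv0 : v (0, 0) ≤ 1) {p : Eucl n} {H : ℝ} (hp : ‖p‖ < 1) (hH1 : 1 < H) (hH2 : H < 2) :
    ∃ P : SpaceTime n, Contact v p H P.1 P.2 ∧ v P ≤ 3 := by
  set Q : Set (SpaceTime n) := closedBall 0 1 ×ˢ Icc (-1) 0 with hQ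
  have hQc : IsCompact Q := (isCompact_closedBall _ _).prod isCompact_Icc
  have hin : ∀ x : Eucl n, ‖x‖ ≤ 1 → ⟪p, x⟫ ≤ 1 := by
    intro x hx
    have := real_inner_le_norm p x
    nlinarith [norm_nonneg p, norm_nonneg x]
  have hgc : ContinuousOn (fun P : SpaceTime n => v P - (⟪p, P.1⟫ + H)) Q := hc.sub (by fun_prop)
  have hNcl : IsClosed (Q ∩ (fun P : SpaceTime n => v P - (⟪p, P.1⟫ + H)) ⁻¹' Iic 0) :=
    hgc.preimage_isClosed_of_isClosed hQc.isClosed isClosed_Iic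
  have hNc := hQc.of_isClosed_subset hNcl inter_subset_left
  have memQ : ∀ x t, (x, t) ∈ Q ↔ ‖x‖ ≤ 1 ∧ -1 ≤ t ∧ t ≤ 0 := by
    intro x t; simp [hQ]
  obtain ⟨⟨x, t⟩, ⟨hPQ, hPle⟩, hmin⟩ := hNc.exists_isMinOn
    ⟨((0 : Eucl n), (0 : ℝ)), (memQ 0 0).2 (by norm_num), by simp; linarith⟩
    (f := fun P => P.2) (by fun_prop)
  simp only [mem_preimage, mem_Iic] at hPle
  obtain ⟨hx, ht1, ht2⟩ := (memQ x t).1 hPQ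
  have hbig := hv x t hx ht1 ht2
  have hinx := hin x hx
  have hlt : ∀ y s, ‖y‖ ≤ 1 → -1 ≤ s → s < t → 0 < v (y, s) - (⟪p, y⟫ + H) := by
    intro y s h1 h2 h3
    by_contra hcon
    push Not at hcon
    have := hmin (show (y, s) ∈ _ from ⟨(memQ y s).2 ⟨h1, h2, by linarith⟩, hcon⟩)
    simp only at this
    exact absurd h3 (not_lt.2 this)
  have hxsq := sq_nonneg ‖x‖
  have ht3 : -3 / 4 ≤ t := by linarith
  have hge : ∀ y s, ‖y‖ ≤ 1 → -1 ≤ s → s ≤ t → 0 ≤ v (y, s) - (⟪p, y⟫ + H) := by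
    intro y s h1 h2 h3
    rcases h3.lt_or_eq with h | h
    · exact (hlt y s h1 h2 h).le
    · subst h
      -- limit from earlier times
      have hcy : ContinuousOn (fun s : ℝ => v (y, s) - (⟪p, y⟫ + H)) (Icc (-1) 0) := by
        have : ContinuousOn (fun s : ℝ => ((y, s) : SpaceTime n)) (Icc (-1) 0) := by fun_prop
        exact hgc.comp this (fun r hr => (memQ y r).2 ⟨h1, hr.1, hr.2⟩)
      have h5 : ContinuousWithinAt (fun s : ℝ => v (y, s) - (⟪p, y⟫ + H)) (Ico (-1) s) s :=
        (hcy s ⟨h2, ht2⟩).mono (fun r hr => ⟨hr.1, hr.2.le.trans ht2⟩)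
      have hcl : s ∈ closure (Ico (-1) s) := by
        rw [closure_Ico (by linarith)]; exact ⟨h2, le_rfl⟩
      have := h5.mem_closure_image hcl
      refine closure_minimal ?_ isClosed_Ici this
      rintro _ ⟨r, hr, rfl⟩
      exact (hlt y r h1 hr.1 hr.2).le
  have heq : v (x, t) = ⟪p, x⟫ + H := by
    have := hge x t hx ht1 le_rfl
    linarith
  refine ⟨(x, t), ⟨?_, ht3, ht2, heq, fun y s h1 h2 h3 => by linarith [hge y s h1 h2 h3]⟩, ?_⟩
  · by_contra hcon
    push Not at hcon
    simp only at hcon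
    nlinarith
  · linarith


lemma vol_box {n : ℕ} (x : Eucl n) (t1 t2 : ℝ) {r : ℝ} (hr : 0 ≤ r) :
    volume (closedBall x r ×ˢ Icc t1 t2 : Set (SpaceTime n)) =
      ENNReal.ofReal (r ^ n) * volume (ball (0 : Eucl n) 1) * ENNReal.ofReal (t2 - t1) := by
  rw [Measure.volume_eq_prod, Measure.prod_prod, Measure.addHaar_closedBall _ _ hr, Real.volume_Icc]
  simp

lemma vol_obox {n : ℕ} (x : Eucl n) (t1 t2 : ℝ) {r : ℝ} (hr : 0 < r) :
    volume (ball x r ×ˢ Ioo t1 t2 : Set (SpaceTime n)) =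
      ENNReal.ofReal (r ^ n) * volume (ball (0 : Eucl n) 1) * ENNReal.ofReal (t2 - t1) := by
  rw [Measure.volume_eq_prod, Measure.prod_prod, Measure.addHaar_ball_of_pos _ _ hr, Real.volume_Ioo]
  simp

lemma vol_shear {n : ℕ} (p1 x : Eucl n) (H1 : ℝ) {r β : ℝ} (hr : 0 ≤ r) :
    volume {P : SpaceTime n | ‖P.1 - p1‖ ≤ r ∧ |P.2 - H1 + ⟪P.1 - p1, x⟫| ≤ β} ≤
      ENNReal.ofReal (r ^ n) * volume (ball (0 : Eucl n) 1) * ENNReal.ofReal (2 * β) := by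
  have hcl : IsClosed {P : SpaceTime n | ‖P.1 - p1‖ ≤ r ∧ |P.2 - H1 + ⟪P.1 - p1, x⟫| ≤ β} := by
    simp only [ofPred_and]
    exact (isClosed_le (by fun_prop) (by fun_prop)).inter (isClosed_le (by fun_prop) (by fun_prop))
  rw [Measure.volume_eq_prod, Measure.prod_apply hcl.measurableSet]
  calc _ ≤ ∫⁻ p, (closedBall p1 r).indicator (fun _ => ENNReal.ofReal (2 * β)) p := by
        apply lintegral_mono
        intro p
        by_cases hp : p ∈ closedBall p1 r
        · rw [indicator_of_mem hp]
          calc _ ≤ volume (Icc (H1 - ⟪p - p1, x⟫ - β) (H1 - ⟪p - p1, x⟫ + β)) := by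
                apply measure_mono
                rintro H ⟨_, h2⟩
                simp only [abs_le] at h2
                constructor <;> linarith
            _ = _ := by rw [Real.volume_Icc]; congr 1; ring
        · rw [indicator_of_notMem hp]
          simp only [nonpos_iff_eq_zero]
          convert measure_empty (μ := (volume : Measure ℝ))
          ext H
          simp only [mem_preimage, mem_empty_iff_false, iff_false]
          rintro ⟨h1, _⟩
          apply hp
          simpa [mem_closedBall, dist_eq_norm] using h1
    _ = _ := by
        rw [lintegral_indicator isClosed_closedBall.measurableSet, setLIntegral_const,
          Measure.addHaar_closedBall _ _ hr, mul_comm]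
        simp

lemma inbox {n : ℕ} {x y w : Eucl n} {t s τ h k : ℝ} (hk : 0 ≤ k) (hkh : k ≤ 2 * h)
    (h1 : ‖w - x‖ < k) (h2 : |τ - t| < k ^ 2) (h3 : ‖w - y‖ < h) (h4 : |τ - s| < h ^ 2) :
    ‖x - y‖ ≤ 3 * h ∧ |t - s| ≤ 5 * h ^ 2 := by
  constructor
  · have e : x - y = (w - y) - (w - x) := by abel
    rw [e]
    refine (norm_sub_le _ _).trans ?_
    linarith
  · rw [abs_lt] at h2 h4
    rw [abs_le]
    constructor <;> nlinarith

set_option maxHeartbeats 800000 in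
lemma abp {n : ℕ} {a nb : ℝ} (ha : 0 < a) (hnb : 0 ≤ nb) :
    ∃ η : ℝ, 0 < η ∧ ∀ (u : SpaceTime n → ℝ) (D : Set (SpaceTime n)),
      ContinuousOn u D → SupT a nb 1 1 u D →
      (∀ x t, ‖x‖ ≤ 1 → -1 ≤ t → t ≤ 0 → (x, t) ∈ D ∧ 0 ≤ u (x, t)) → u (0, 0) ≤ 1 →
      ENNReal.ofReal η ≤
        volume {P : SpaceTime n | ‖P.1‖ ≤ 1 ∧ -1 ≤ P.2 ∧ P.2 ≤ 0 ∧ u P ≤ 3} := by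
  set f : ℝ := 1 + 2 * nb * 4 + 4 with hf
  set C1 : ℝ := 2 * f * Real.exp (2 * alph a nb 15) with hC1
  have hf0 : 0 < f := by positivity
  have hC10 : 0 < C1 := by positivity
  set K1 : ℝ := (3 * C1) ^ n * (18 * C1) with hK1
  have hK10 : 0 < K1 := by positivity
  set ω := volume (ball (0 : Eucl n) 1) with hω
  have hω0 : 0 < ω := measure_ball_pos _ _ one_pos
  have hωt : ω ≠ ⊤ := measure_ball_lt_top.ne
  have hωr : 0 < ω.toReal := ENNReal.toReal_pos hω0.ne' hωt
  refine ⟨ω.toReal / K1, by positivity, ?_⟩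
  intro u D hc hS hu hu0
  set G := {P : SpaceTime n | ‖P.1‖ ≤ 1 ∧ -1 ≤ P.2 ∧ P.2 ≤ 0 ∧ u P ≤ 3} with hG
  by_contra hcon
  push Not at hcon
  obtain ⟨U, hGU, hUo, hU⟩ := Set.exists_isOpen_lt_of_lt G _ hcon
  set v : SpaceTime n → ℝ := fun P => u P + 4 * ‖P.1‖ ^ 2 - 4 * P.2 with hv
  have hvc : ContinuousOn v D := (hc.add (by fun_prop)).sub (by fun_prop)
  have hvS : ∀ p H, SupT a nb 1 f (fun P => v P - (⟪p, P.1⟫ + H)) D := fun p H =>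
    hS.add hnb 4 (by norm_num) p H
  have hQD : (closedBall 0 1 ×ˢ Icc (-1) 0 : Set (SpaceTime n)) ⊆ D := by
    rintro ⟨x, t⟩ ⟨h1, h2⟩
    exact (hu x t (by simpa using h1) h2.1 h2.2).1
  set V : Set (SpaceTime n) := ball 0 1 ×ˢ Ioo 1 2 with hV
  have hex : ∀ q : SpaceTime n, q ∈ V → ∃ P : SpaceTime n, Contact v q.1 q.2 P.1 P.2 ∧ v P ≤ 3 := by
    rintro ⟨p, H⟩ ⟨h1, h2⟩
    apply exists_contact (hvc.mono hQD) _ _ (by simpa using h1) h2.1 h2.2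
    · intro x t h1 h2 h3
      have := (hu x t h1 h2 h3).2
      simp only [hv]; linarith
    · simp [hv]; exact hu0
  choose! Z hZ hZ3 using hex
  have hZG : ∀ q ∈ V, Z q ∈ G := by
    intro q hq
    obtain ⟨h1, h2, h3, h4, h5⟩ := hZ q hq
    have h6 := hZ3 q hq
    refine ⟨by linarith, by linarith, h3, ?_⟩
    simp only [hv] at h6
    nlinarith [sq_nonneg ‖(Z q).1‖]
  have hrad : ∀ q : SpaceTime n, q ∈ V → ∃ h : ℝ, 0 < h ∧ h ≤ 1 / 1000 ∧
      (ball (Z q).1 h ×ˢ Ioo ((Z q).2 - h ^ 2) ((Z q).2 + h ^ 2) : Set (SpaceTime n)) ⊆ U := by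
    intro q hq
    obtain ⟨ε, hε, hb⟩ := Metric.isOpen_iff.1 hUo _ (hGU (hZG q hq))
    have k1 : min (1 / 1000) ε ≤ ε := min_le_right _ _
    have k2 : min (1 / 1000) ε ≤ 1 / 1000 := min_le_left _ _
    have k3 : 0 < min (1 / 1000) ε := by positivity
    refine ⟨min (1 / 1000) ε, k3, k2, ?_⟩
    rintro ⟨x, t⟩ ⟨h1, h2⟩
    apply hb
    simp only [mem_ball, mem_Ioo] at h1 h2
    rw [mem_ball, Prod.dist_eq, max_lt_iff]
    refine ⟨lt_of_lt_of_le h1 k1, ?_⟩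
    simp only [Real.dist_eq]
    rw [abs_lt]
    constructor <;> nlinarith
  choose! h hh0 hh1 hhU using hrad
  set Bx : SpaceTime n → Set (SpaceTime n) := fun q =>
    ball (Z q).1 (h q) ×ˢ Ioo ((Z q).2 - h q ^ 2) ((Z q).2 + h q ^ 2) with hBx
  have hBxo : ∀ q, IsOpen (Bx q) := fun q => isOpen_ball.prod isOpen_Ioo
  have hBxne : ∀ q ∈ V, (Bx q).Nonempty := fun q hq => ⟨Z q, mem_ball_self (hh0 q hq), by
    have := hh0 q hq
    constructor <;> nlinarith⟩
  obtain ⟨I, hIV, hId, hIc⟩ := Vitali.exists_disjoint_subfamily_covering_enlargement Bx V h 2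
    one_lt_two (fun q hq => (hh0 q hq).le) (1 / 1000) hh1 hBxne
  have hIcount : I.Countable := hId.countable_of_isOpen (fun q _ => hBxo q)
    (fun q hq => hBxne q (hIV hq))
  set W : SpaceTime n → Set (SpaceTime n) := fun b =>
    {P | ‖P.1 - b.1‖ ≤ 3 * C1 * h b ∧ |P.2 - b.2 + ⟪P.1 - b.1, (Z b).1⟫| ≤ 18 * C1 * h b ^ 2} with hW
  have hcov : V ⊆ ⋃ b ∈ I, W b := by
    intro q hq
    obtain ⟨b, hb, ⟨⟨w, τ⟩, ⟨hw1, hw2⟩, ⟨hw3, hw4⟩⟩, hδ⟩ := hIc q hq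
    rw [mem_iUnion₂]
    refine ⟨b, hb, ?_⟩
    have hbV := hIV hb
    have p1 := hh0 q hq
    have p2 := hh0 b hbV
    have p3 := hh1 b hbV
    simp only [mem_ball, dist_eq_norm, mem_Ioo] at hw1 hw2 hw3 hw4
    obtain ⟨i1, i2⟩ := inbox (x := (Z q).1) (y := (Z b).1) (t := (Z q).2) (s := (Z b).2) (τ := τ)
      p1.le hδ hw1 (abs_lt.2 ⟨by linarith, by linarith⟩) hw3 (abs_lt.2 ⟨by linarith, by linarith⟩)
    rw [abs_le] at i2
    have hsq : (3 * h b) ^ 2 = 9 * h b ^ 2 := by ring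
    have hhb2 : 0 < h b ^ 2 := by positivity
    rcases le_total (Z q).2 (Z b).2 with hle | hle
    · obtain ⟨j1, j2⟩ := contact_close ha hf0.le hvc (fun x t h1 h2 h3 => (hu x t h1 h2 h3).1) hvS
        (hZ b hbV) (hZ q hq) hle (h := 3 * h b) (by positivity) (by linarith) i1 (by linarith)
      rw [← hC1, hsq] at j2
      have hn : ‖q.1 - b.1‖ ≤ 3 * C1 * h b := by
        have : 3 * h b * ‖q.1 - b.1‖ ≤ 3 * h b * (3 * C1 * h b) := by linarith
        exact le_of_mul_le_mul_left this (by positivity)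
      refine ⟨hn, ?_⟩
      have e : ⟪q.1 - b.1, (Z b).1⟫ = ⟪q.1 - b.1, (Z q).1⟫ - ⟪q.1 - b.1, (Z q).1 - (Z b).1⟫ := by
        rw [inner_sub_right]; ring
      have e2 : |⟪q.1 - b.1, (Z q).1 - (Z b).1⟫| ≤ 9 * C1 * h b ^ 2 := by
        refine (abs_real_inner_le_norm _ _).trans ?_
        calc _ ≤ (3 * C1 * h b) * (3 * h b) := by gcongr
          _ = _ := by ring
      have e3 : 0 ≤ 3 * h b * ‖q.1 - b.1‖ := by positivity
      have e4 : 0 ≤ C1 * h b ^ 2 := by positivity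
      rw [abs_le] at e2 ⊢
      rw [e]
      constructor <;> linarith
    · obtain ⟨j1, j2⟩ := contact_close ha hf0.le hvc (fun x t h1 h2 h3 => (hu x t h1 h2 h3).1) hvS
        (hZ q hq) (hZ b hbV) hle (h := 3 * h b) (by positivity) (by linarith)
        (by rw [norm_sub_rev]; exact i1) (by linarith)
      rw [← hC1, hsq, norm_sub_rev] at j2
      have hn : ‖q.1 - b.1‖ ≤ 3 * C1 * h b := by
        have : 3 * h b * ‖q.1 - b.1‖ ≤ 3 * h b * (3 * C1 * h b) := by linarith
        exact le_of_mul_le_mul_left this (by positivity)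
      refine ⟨hn, ?_⟩
      have e : ⟪q.1 - b.1, (Z b).1⟫ = - ⟪b.1 - q.1, (Z b).1⟫ := by
        rw [← inner_neg_left, neg_sub]
      have e3 : 0 ≤ 3 * h b * ‖q.1 - b.1‖ := by positivity
      have e4 : 0 ≤ C1 * h b ^ 2 := by positivity
      rw [abs_le, e]
      constructor <;> linarith
  have hVvol : volume V = ω := by
    rw [hV, vol_obox _ _ _ one_pos]; norm_num; rfl
  have hWvol : ∀ b ∈ I, volume (W b) ≤ ENNReal.ofReal K1 * volume (Bx b) := by
    intro b hb
    have p2 := hh0 b (hIV hb)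
    refine (vol_shear b.1 (Z b).1 b.2 (by positivity)).trans (le_of_eq ?_)
    rw [hBx, vol_obox _ _ _ p2, ← hω]
    calc _ = ω * (ENNReal.ofReal ((3 * C1 * h b) ^ n) * ENNReal.ofReal (2 * (18 * C1 * h b ^ 2))) := by
          ring
      _ = ω * (ENNReal.ofReal K1 * ENNReal.ofReal (h b ^ n) *
            ENNReal.ofReal ((Z b).2 + h b ^ 2 - ((Z b).2 - h b ^ 2))) := by
          rw [← ENNReal.ofReal_mul (by positivity), ← ENNReal.ofReal_mul (by positivity),
            ← ENNReal.ofReal_mul (by positivity)]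
          congr 2
          rw [hK1, mul_pow]
          ring
      _ = _ := by ring
  have hfin : ω ≤ ENNReal.ofReal K1 * volume U := by
    calc ω = volume V := hVvol.symm
      _ ≤ volume (⋃ b ∈ I, W b) := measure_mono hcov
      _ ≤ ∑' b : I, volume (W b) := measure_biUnion_le _ hIcount _
      _ ≤ ∑' b : I, ENNReal.ofReal K1 * volume (Bx b) :=
          ENNReal.tsum_le_tsum fun b => hWvol b b.2
      _ = ENNReal.ofReal K1 * volume (⋃ b ∈ I, Bx b) := by
          rw [ENNReal.tsum_mul_left, measure_biUnion hIcount hId (fun b _ => (hBxo b).measurableSet)]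
      _ ≤ _ := by
          gcongr
          exact iUnion₂_subset fun b hb => hhU b (hIV hb)
  have hlt : ENNReal.ofReal K1 * volume U < ω := by
    calc _ < ENNReal.ofReal K1 * ENNReal.ofReal (ω.toReal / K1) := by
          apply ENNReal.mul_lt_mul_right _ _ hU
          · simpa using hK10
          · exact ENNReal.ofReal_ne_top
      _ = ω := by
          rw [← ENNReal.ofReal_mul hK10.le, mul_div_cancel₀ _ hK10.ne', ENNReal.ofReal_toReal hωt]
  exact absurd hfin (not_le.2 hlt)


lemma SupT.mono {n : ℕ} {a nb lam f f' : ℝ} {u : SpaceTime n → ℝ} {D : Set (SpaceTime n)}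
    (h : SupT a nb lam f u D) (hf : f ≤ f') : SupT a nb lam f' u D := by
  intro A B C A' B' C' z p x0 t0 ε hA hB hC cA cB cC hε hm hA0 he ht
  have := h A B C A' B' C' z p x0 t0 ε hA hB hC cA cB cC hε hm hA0 he ht
  linarith

def Dr {n : ℕ} (x : Eucl n) (t r : ℝ) : Set (SpaceTime n) :=
  {P | ‖P.1 - x‖ ^ 2 < P.2 - t ∧ P.2 - t < r ^ 2}

lemma Dr_open {n : ℕ} (x : Eucl n) (t r : ℝ) : IsOpen (Dr x t r) := by
  simp only [Dr, ofPred_and]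
  exact (isOpen_lt (by fun_prop) (by fun_prop)).inter (isOpen_lt (by fun_prop) (by fun_prop))

lemma vol_affine {n : ℕ} (y : Eucl n) (t' : ℝ) {ρ : ℝ} (hρ : 0 < ρ) (A : Set (SpaceTime n)) :
    ENNReal.ofReal (ρ ^ (n + 2)) *
      volume ((fun P : SpaceTime n => (y + ρ • P.1, t' + ρ ^ 2 * P.2)) ⁻¹' A) = volume A := by
  set L : SpaceTime n →ₗ[ℝ] SpaceTime n :=
    LinearMap.prodMap (ρ • LinearMap.id) ((ρ ^ 2) • LinearMap.id) with hL
  have hdet : LinearMap.det L = ρ ^ (n + 2) := by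
    rw [hL, LinearMap.det_prodMap, LinearMap.det_smul, LinearMap.det_smul]
    simp [pow_add]
  have hd0 : 0 < LinearMap.det L := by rw [hdet]; positivity
  have e : (fun P : SpaceTime n => (y + ρ • P.1, t' + ρ ^ 2 * P.2)) ⁻¹' A =
      L ⁻¹' ((fun P => (y, t') + P) ⁻¹' A) := by
    ext P; simp [hL]
  have hI : (volume : Measure (SpaceTime n)).IsAddHaarMeasure := by
    rw [Measure.volume_eq_prod]; infer_instance
  rw [e, Measure.addHaar_preimage_linearMap _ hd0.ne', measure_preimage_add, hdet, ← mul_assoc,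
    ← ENNReal.ofReal_mul (by positivity), abs_of_pos (by positivity),
    mul_inv_cancel₀ (by positivity)]
  simp

lemma loc {n : ℕ} {a nb : ℝ} (ha : 0 < a) (hnb : 0 ≤ nb) :
    ∃ η : ℝ, 0 < η ∧ ∀ (u : SpaceTime n → ℝ) (D E : Set (SpaceTime n)) (f m r t : ℝ) (x : Eucl n),
      ContinuousOn u D → SupT a nb 1 f u D → 0 ≤ f → 0 < m → 0 < r → r ≤ 1 → f ≤ m →
      (∀ P ∈ Dr x t r, P ∈ D ∧ 0 ≤ u P) → (∀ P ∈ E, m < u P) →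
      volume (Dr x t r \ E) < ENNReal.ofReal (η * r ^ (n + 2)) →
      ∀ y, ‖y - x‖ ≤ r / 4 → m / 3 < u (y, t + r ^ 2 / 2) := by
  obtain ⟨η, hη, h⟩ := abp (n := n) ha hnb
  refine ⟨η * (1 / 4) ^ (n + 2), by positivity, ?_⟩
  intro u D E f m r t x hc hS hf hm hr hr1 hfm hu hE hvol y hy
  by_contra hcon
  push Not at hcon
  have hr4 : 0 < r / 4 := by positivity
  have hm3 : 0 < m / 3 := by positivity
  set φ : SpaceTime n → SpaceTime n :=
    fun P => (y + (r / 4) • P.1, (t + r ^ 2 / 2) + (r / 4) ^ 2 * P.2) with hφ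
  have hφc : Continuous φ := by fun_prop
  have hin : ∀ x' t', ‖x'‖ ≤ 1 → -1 ≤ t' → t' ≤ 0 → φ (x', t') ∈ Dr x t r := by
    intro x' t' h1 h2 h3
    have e : ‖y + (r / 4) • x' - x‖ ≤ r / 2 := by
      calc _ = ‖(y - x) + (r / 4) • x'‖ := by congr 1; abel
        _ ≤ ‖y - x‖ + ‖(r / 4) • x'‖ := norm_add_le _ _
        _ ≤ r / 4 + r / 4 * 1 := by
            rw [norm_smul, Real.norm_of_nonneg hr4.le]
            gcongr
        _ = _ := by ring
    have e2 : ‖y + (r / 4) • x' - x‖ ^ 2 ≤ (r / 2) ^ 2 := by gcongr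
    have hr2 : 0 < r ^ 2 := by positivity
    constructor
    · simp only [hφ]
      nlinarith
    · simp only [hφ]
      nlinarith
  have hS2 := (hS.scale y (t + r ^ 2 / 2) 0 one_pos hr4 hm3).mono (f' := 1) (by
    rw [div_le_one hm3]
    have : (r / 4) ^ 2 ≤ (1 / 4) ^ 2 := by gcongr
    nlinarith)
  have eφ : (fun P : SpaceTime n => (y + (r / 4) • P.1, t + r ^ 2 / 2 + 1 * (r / 4) ^ 2 * P.2)) = φ := by
    funext P; simp [hφ]
  have eu : (fun P : SpaceTime n => (u (y + (r / 4) • P.1, t + r ^ 2 / 2 + 1 * (r / 4) ^ 2 * P.2) - 0) / (m / 3)) =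
      fun P => u (φ P) / (m / 3) := by
    funext P; simp [hφ]
  rw [eφ, eu] at hS2
  have key := h _ _ ((hc.comp hφc.continuousOn (mapsTo_preimage _ _)).div_const _) hS2 (by
    intro x' t' h1 h2 h3
    obtain ⟨k1, k2⟩ := hu _ (hin x' t' h1 h2 h3)
    exact ⟨k1, by positivity⟩) (by
    rw [Function.comp_apply, div_le_one hm3]
    simpa [hφ] using hcon)
  have hsub : {P : SpaceTime n | ‖P.1‖ ≤ 1 ∧ -1 ≤ P.2 ∧ P.2 ≤ 0 ∧ (u ∘ φ) P / (m / 3) ≤ 3} ⊆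
      φ ⁻¹' (Dr x t r \ E) := by
    rintro ⟨x', t'⟩ ⟨h1, h2, h3, h4⟩
    refine ⟨hin x' t' h1 h2 h3, fun hE' => ?_⟩
    have := hE _ hE'
    rw [Function.comp_apply, div_le_iff₀ hm3] at h4
    linarith
  have k := vol_affine y (t + r ^ 2 / 2) hr4 (Dr x t r \ E)
  have k2 := key.trans (measure_mono hsub)
  rw [← k] at hvol
  have : ENNReal.ofReal (η * (1 / 4) ^ (n + 2) * r ^ (n + 2)) ≤
      ENNReal.ofReal ((r / 4) ^ (n + 2)) * volume (φ ⁻¹' (Dr x t r \ E)) := by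
    calc _ = ENNReal.ofReal ((r / 4) ^ (n + 2)) * ENNReal.ofReal η := by
          rw [← ENNReal.ofReal_mul (by positivity)]
          congr 1
          rw [div_eq_mul_one_div r 4, mul_pow]; ring
      _ ≤ _ := by gcongr
  exact absurd hvol (not_lt.2 this)


def LocP (n : ℕ) (a nb η : ℝ) : Prop :=
  ∀ (u : SpaceTime n → ℝ) (D E : Set (SpaceTime n)) (f m r t : ℝ) (x : Eucl n),
      ContinuousOn u D → SupT a nb 1 f u D → 0 ≤ f → 0 < m → 0 < r → r ≤ 1 → f ≤ m →
      (∀ P ∈ Dr x t r, P ∈ D ∧ 0 ≤ u P) → (∀ P ∈ E, m < u P) →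
      volume (Dr x t r \ E) < ENNReal.ofReal (η * r ^ (n + 2)) →
      ∀ y, ‖y - x‖ ≤ r / 4 → m / 3 < u (y, t + r ^ 2 / 2)

lemma Dr_norm {n : ℕ} {x : Eucl n} {t r : ℝ} (hr : 0 < r) {P : SpaceTime n} (h : P ∈ Dr x t r) :
    ‖P.1 - x‖ < r ∧ |P.2 - t| < r ^ 2 := by
  obtain ⟨h1, h2⟩ := h
  constructor
  · exact lt_of_pow_lt_pow_left₀ 2 hr.le (h1.trans h2)
  · rw [abs_lt]; constructor <;> nlinarith [sq_nonneg ‖P.1 - x‖]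

lemma Dr_ne {n : ℕ} (x : Eucl n) (t : ℝ) {r : ℝ} (hr : 0 < r) : (Dr x t r).Nonempty := by
  refine ⟨(x, t + r ^ 2 / 2), ?_, ?_⟩
  · simp; positivity
  · simp; positivity

lemma vit {n : ℕ} {η : ℝ} (hη : 0 < η) (E F : Set (SpaceTime n)) (hE : MeasurableSet E)
    (hF : MeasurableSet F) (r : SpaceTime n → ℝ) (h0 : ∀ p ∈ E, 0 < r p) (h1 : ∀ p ∈ E, r p ≤ 1)
    (hv : ∀ p ∈ E, ENNReal.ofReal (η * r p ^ (n + 2)) ≤ volume ((Dr p.1 p.2 (r p) ∩ F) \ E)) :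
    ENNReal.ofReal η * volume E ≤
      ENNReal.ofReal (3 ^ n * 10) * volume (ball (0 : Eucl n) 1) * volume (F \ E) := by
  obtain ⟨I, hIV, hId, hIc⟩ := Vitali.exists_disjoint_subfamily_covering_enlargement
    (fun p : SpaceTime n => Dr p.1 p.2 (r p)) E r 2
    one_lt_two (fun q hq => (h0 q hq).le) 1 h1 (fun q hq => Dr_ne _ _ (h0 q hq))
  have hIcount : I.Countable := hId.countable_of_isOpen (fun q _ => Dr_open _ _ _)
    (fun q hq => Dr_ne _ _ (h0 q (hIV hq)))
  set W : SpaceTime n → Set (SpaceTime n) := fun b =>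
    closedBall b.1 (3 * r b) ×ˢ Icc (b.2 - 5 * r b ^ 2) (b.2 + 5 * r b ^ 2) with hW
  have hcov : E ⊆ ⋃ b ∈ I, W b := by
    intro q hq
    obtain ⟨b, hb, ⟨w, hw1, hw2⟩, hδ⟩ := hIc q hq
    rw [mem_iUnion₂]
    refine ⟨b, hb, ?_⟩
    obtain ⟨k1, k2⟩ := Dr_norm (h0 q hq) hw1
    obtain ⟨k3, k4⟩ := Dr_norm (h0 b (hIV hb)) hw2
    obtain ⟨i1, i2⟩ := inbox (h0 q hq).le hδ k1 k2 k3 k4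
    rw [abs_le] at i2
    refine ⟨by rwa [mem_closedBall, dist_eq_norm], by linarith, by linarith⟩
  set ω := volume (ball (0 : Eucl n) 1) with hω
  calc ENNReal.ofReal η * volume E ≤ ENNReal.ofReal η * ∑' b : I, volume (W b) := by
        gcongr
        exact (measure_mono hcov).trans (measure_biUnion_le _ hIcount _)
    _ = ∑' b : I, ENNReal.ofReal η * volume (W b) := by rw [ENNReal.tsum_mul_left]
    _ ≤ ∑' b : I, ENNReal.ofReal (3 ^ n * 10) * ω * volume ((Dr b.1.1 b.1.2 (r b) ∩ F) \ E) := by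
        apply ENNReal.tsum_le_tsum
        rintro ⟨b, hb⟩
        have p := h0 b (hIV hb)
        have q := hv b (hIV hb)
        rw [hW, vol_box _ _ _ (by positivity)]
        calc _ = ENNReal.ofReal (3 ^ n * 10) * ω * ENNReal.ofReal (η * r b ^ (n + 2)) := by
              rw [show b.2 + 5 * r b ^ 2 - (b.2 - 5 * r b ^ 2) = 10 * r b ^ 2 by ring, ← hω,
                mul_right_comm, mul_right_comm (ENNReal.ofReal (3 ^ n * 10)), ← mul_assoc,
                ← ENNReal.ofReal_mul (by positivity), ← ENNReal.ofReal_mul (by positivity),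
                ← ENNReal.ofReal_mul (by positivity)]
              congr 2
              rw [mul_pow]; ring
          _ ≤ _ := by gcongr
    _ = ENNReal.ofReal (3 ^ n * 10) * ω * volume (⋃ b ∈ I, ((Dr b.1 b.2 (r b) ∩ F) \ E)) := by
        rw [ENNReal.tsum_mul_left, measure_biUnion hIcount]
        · exact hId.mono fun b => sdiff_subset.trans inter_subset_left
        · exact fun b _ => ((Dr_open _ _ _).measurableSet.inter hF).diff hE
    _ ≤ _ := by
        gcongr
        exact iUnion₂_subset fun b _ => sdiff_subset_sdiff_left inter_subset_right

lemma small_Dr {n : ℕ} {E : Set (SpaceTime n)} (hE : IsOpen E) {p : SpaceTime n} (hp : p ∈ E)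
    {r0 : ℝ} (hr0 : 0 < r0) (hr1 : r0 ≤ 1) : ∃ k : ℕ, Dr p.1 p.2 (r0 / 2 ^ k) ⊆ E := by
  obtain ⟨ε, hε, hb⟩ := Metric.isOpen_iff.1 hE _ hp
  obtain ⟨k, hk⟩ := exists_pow_lt_of_lt_one hε (by norm_num : (1 / 2 : ℝ) < 1)
  refine ⟨k, fun P hP => hb ?_⟩
  have h2 : 0 < (1 / 2 : ℝ) ^ k := by positivity
  have h3 : (1 / 2 : ℝ) ^ k ≤ 1 := pow_le_one₀ (by norm_num) (by norm_num)
  have h4 : r0 / 2 ^ k = r0 * (1 / 2) ^ k := by rw [one_div, inv_pow]; rfl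
  rw [h4] at hP
  have h5 : r0 * (1 / 2) ^ k ≤ (1 / 2) ^ k := by nlinarith
  obtain ⟨k1, k2⟩ := Dr_norm (by positivity) hP
  have h6 : 0 < r0 * (1 / 2) ^ k := by positivity
  rw [mem_ball, Prod.dist_eq, max_lt_iff, dist_eq_norm, Real.dist_eq]
  constructor
  · linarith
  · nlinarith

lemma lvl_open {n : ℕ} {u : SpaceTime n → ℝ} {K : Set (SpaceTime n)} (hK : IsOpen K)
    (hc : ContinuousOn u K) (m : ℝ) : IsOpen {P | P ∈ K ∧ m < u P} :=
  hc.isOpen_inter_preimage hK isOpen_Ioi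

set_option maxHeartbeats 800000 in
lemma inkstep {n : ℕ} {a nb η : ℝ} (ha : 0 < a) (hη : 0 < η) (hloc : LocP n a nb η) :
    ∃ σ c : ℝ, 0 < σ ∧ 0 < c ∧ c < 1 ∧ ∀ (u : SpaceTime n → ℝ) (D : Set (SpaceTime n))
      (f m r0 R s1 s2 : ℝ),
      ContinuousOn u D → SupT a nb 1 f u D → 0 ≤ f → 0 < m → 0 < r0 → r0 ≤ 1 → f ≤ c * m →
      (∀ x t, ‖x‖ < R + 4 * r0 → s1 < t → t < s2 + r0 → (x, t) ∈ D ∧ 0 ≤ u (x, t)) →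
      (∃ p : SpaceTime n, p ∈ (ball 0 R ×ˢ Ioo s1 s2 : Set (SpaceTime n)) ∧
        ∀ y, ‖y - p.1‖ ≤ r0 / 4 → m / 3 < u (y, p.2 + r0 ^ 2 / 2)) ∨
      ENNReal.ofReal (1 + σ) * volume {P | P ∈ (ball 0 R ×ˢ Ioo s1 s2 : Set (SpaceTime n)) ∧ m < u P} ≤
        volume {P | P ∈ (ball 0 (R + r0) ×ˢ Ioo s1 (s2 + r0) : Set (SpaceTime n)) ∧ c * m < u P} := by
  set α := alph a nb 16 with hα
  have hα0 : 0 ≤ α := alph_nonneg ha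
  set c : ℝ := Real.exp (-(56 * α)) / 12 with hcdef
  have hc0 : 0 < c := by positivity
  have hc1 : c < 1 := by
    have : Real.exp (-(56 * α)) ≤ 1 := Real.exp_le_one_iff.2 (by linarith)
    rw [hcdef]; linarith
  set ω := volume (ball (0 : Eucl n) 1) with hω
  have hω0 : 0 < ω := measure_ball_pos _ _ one_pos
  have hωt : ω ≠ ⊤ := measure_ball_lt_top.ne
  have hωr : 0 < ω.toReal := ENNReal.toReal_pos hω0.ne' hωt
  refine ⟨η / 2 / (3 ^ n * 10 * ω.toReal), c, by positivity, hc0, hc1, ?_⟩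
  intro u D f m r0 R s1 s2 hc hS hf hm hr0 hr1 hfm hD
  set K : Set (SpaceTime n) := ball 0 R ×ˢ Ioo s1 s2 with hK
  set K' : Set (SpaceTime n) := ball 0 (R + r0) ×ˢ Ioo s1 (s2 + r0) with hK'
  set E := {P | P ∈ K ∧ m < u P} with hE
  set F := {P | P ∈ K' ∧ c * m < u P} with hF
  have hKK : K ⊆ K' := by
    rintro ⟨x, t⟩ ⟨h1, h2⟩
    exact ⟨ball_subset_ball (by linarith) h1, h2.1, h2.2.trans (by linarith)⟩
  have hKD : K' ⊆ D := by
    rintro ⟨x, t⟩ ⟨h1, h2⟩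
    refine (hD x t ?_ h2.1 h2.2).1
    have : ‖x‖ < R + r0 := by simpa using h1
    linarith
  have hEo : IsOpen E := lvl_open (isOpen_ball.prod isOpen_Ioo) (hc.mono (hKK.trans hKD)) m
  have hFo : IsOpen F := lvl_open (isOpen_ball.prod isOpen_Ioo) (hc.mono hKD) _
  have hEF : E ⊆ F := fun P hP => ⟨hKK hP.1, lt_of_le_of_lt (by nlinarith) hP.2⟩
  have hmf : f ≤ m := by nlinarith
  -- points of `Dr`
  have hDr : ∀ p ∈ K, ∀ r, 0 < r → r ≤ r0 → ∀ P ∈ Dr p.1 p.2 r, P ∈ K' := by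
    rintro ⟨x, t⟩ ⟨h1, h2⟩ r hr hrr ⟨y, s⟩ hP
    obtain ⟨k1, k2⟩ := Dr_norm hr hP
    have k3 := hP.1
    simp only [mem_ball, dist_zero_right, mem_Ioo, abs_lt] at h1 h2 k1 k2 k3
    refine ⟨?_, ?_, ?_⟩
    · rw [mem_ball, dist_zero_right]
      have := norm_le_norm_add_norm_sub' y x
      simp only
      linarith
    · simp only
      nlinarith [sq_nonneg ‖y - x‖]
    · simp only
      nlinarith
  have hDu : ∀ p ∈ K, ∀ r, 0 < r → r ≤ r0 → ∀ P ∈ Dr p.1 p.2 r, P ∈ D ∧ 0 ≤ u P := by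
    intro p hp r hr hrr P hP
    have := hDr p hp r hr hrr P hP
    obtain ⟨h1, h2⟩ := this
    have : ‖P.1‖ < R + r0 := by simpa using h1
    exact hD P.1 P.2 (by linarith) h2.1 h2.2
  by_cases hex : ∃ p ∈ E, volume (Dr p.1 p.2 r0 \ E) < ENNReal.ofReal (η * r0 ^ (n + 2))
  · left
    obtain ⟨p, hp, hv⟩ := hex
    exact ⟨p, hp.1, hloc u D E f m r0 p.2 p.1 hc hS hf hm hr0 hr1 hmf (hDu p hp.1 r0 hr0 le_rfl)
      (fun P hP => hP.2) hv⟩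
  right
  push Not at hex
  have hsel : ∀ p ∈ E, ∃ r, 0 < r ∧ r ≤ r0 ∧
      ENNReal.ofReal (η * r ^ (n + 2)) ≤ volume (Dr p.1 p.2 r \ E) ∧
      volume (Dr p.1 p.2 (r / 2) \ E) < ENNReal.ofReal (η * (r / 2) ^ (n + 2)) := by
    intro p hp
    have hk : ∃ k : ℕ, volume (Dr p.1 p.2 (r0 / 2 ^ k) \ E) <
        ENNReal.ofReal (η * (r0 / 2 ^ k) ^ (n + 2)) := by
      obtain ⟨k, hk⟩ := small_Dr hEo hp hr0 hr1
      refine ⟨k, ?_⟩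
      rw [sdiff_eq_empty.2 hk, measure_empty, ENNReal.ofReal_pos]
      positivity
    classical
    obtain ⟨j, hj⟩ : ∃ j, Nat.find hk = j + 1 := by
      apply Nat.exists_eq_succ_of_ne_zero
      intro h0
      have := Nat.find_spec hk
      rw [h0] at this
      simp only [pow_zero, div_one] at this
      exact absurd this (not_lt.2 (hex p hp))
    have h1 := Nat.find_spec hk
    have h2 := Nat.find_min hk (m := j) (by omega)
    rw [hj] at h1
    refine ⟨r0 / 2 ^ j, by positivity, div_le_self hr0.le (one_le_pow₀ (by norm_num)), not_lt.1 h2, ?_⟩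
    rw [div_div, ← pow_succ]
    exact h1
  choose! r hrp hrr hr2 hr3 using hsel
  have key : ∀ {x y : Eucl n} {t s ρ : ℝ}, s1 < t → t < s2 → ‖x‖ < R → 0 < ρ → ρ ≤ r0 →
      (∀ P ∈ Dr x t (ρ / 2), P ∈ D ∧ 0 ≤ u P) →
      volume (Dr x t (ρ / 2) \ E) < ENNReal.ofReal (η * (ρ / 2) ^ (n + 2)) →
      (y, s) ∈ Dr x t ρ → (y, s) ∉ Dr x t (ρ / 2) → c * m < u (y, s) := by
    intro x y t s ρ ht1 ht2 hx' hρ hρ0 hDu' hv3 hP hPn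
    have hl := hloc u D E f m (ρ / 2) t x hc hS hf hm (by positivity) (by linarith) hmf
      hDu' (fun P hP => hP.2) hv3
    have hP1 : ‖y - x‖ ^ 2 < s - t := hP.1
    have hP2 : s - t < ρ ^ 2 := hP.2
    have hP3 : ρ ^ 2 / 4 ≤ s - t := by
      by_contra hcon
      exact hPn ⟨hP.1, by simp only; push Not at hcon; linarith⟩
    have hρ2 : 0 < ρ ^ 2 := by positivity
    have hρr : ρ ^ 2 ≤ r0 := by nlinarith
    have hsp := spread hS hc ha hf (z := x) (s := t + ρ ^ 2 / 8) (ρ := ρ / 8) (κ := 16)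
      (T := 7 * ρ ^ 2 / 8) (m := m / 3) (by positivity) (by norm_num) (by positivity) (by
        intro x' t' h1 h2 h3
        apply hD
        · have : ‖x' - x‖ ^ 2 < (4 * ρ) ^ 2 := by nlinarith
          have := lt_of_pow_lt_pow_left₀ 2 (by positivity) this
          have := norm_le_norm_add_norm_sub' x' x
          linarith
        · linarith
        · linarith) (by
        intro x' h1
        have := hl x' (by linarith)
        rw [show t + (ρ / 2) ^ 2 / 2 = t + ρ ^ 2 / 8 by ring] at this
        exact this.le) y s (by linarith) (by linarith) (by nlinarith)
    rw [← hα] at hsp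
    set e := s - (t + ρ ^ 2 / 8) with he
    have he1 : e ≤ 7 * ρ ^ 2 / 8 := by linarith
    have he0 : 0 ≤ e := by linarith
    have hexp : 12 * c ≤ Real.exp (-(α / (ρ / 8) ^ 2 * e)) := by
      rw [hcdef, mul_div_cancel₀ _ (by norm_num)]
      apply Real.exp_le_exp.2
      have : α / (ρ / 8) ^ 2 * e ≤ α / (ρ / 8) ^ 2 * (7 * ρ ^ 2 / 8) := by gcongr
      have e2 : α / (ρ / 8) ^ 2 * (7 * ρ ^ 2 / 8) = 56 * α := by field_simp; ring
      linarith
    have hw : 1 ≤ (((ρ / 8) ^ 2 + 16 * e - ‖y - x‖ ^ 2) / (ρ / 8) ^ 2) ^ 2 := by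
      apply one_le_pow₀
      rw [one_le_div (by positivity)]
      linarith
    have hρ1 : ρ ^ 2 ≤ 1 := by linarith
    have h6 : f * e ≤ c * m := by nlinarith
    have h7 : m / 3 * (12 * c) * 1 ≤ m / 3 * Real.exp (-(α / (ρ / 8) ^ 2 * e)) *
        (((ρ / 8) ^ 2 + 16 * e - ‖y - x‖ ^ 2) / (ρ / 8) ^ 2) ^ 2 := by gcongr
    have h8 : 0 < c * m := by positivity
    linarith
  have hmain : ∀ p ∈ E, ∀ P ∈ Dr p.1 p.2 (r p), P ∉ Dr p.1 p.2 (r p / 2) → P ∈ F := by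
    rintro ⟨x, t⟩ hp ⟨y, s⟩ hP hPn
    refine ⟨hDr _ hp.1 _ (hrp _ hp) (hrr _ hp) _ hP, ?_⟩
    have h3 := hr3 (x, t) hp
    obtain ⟨⟨hx, ht1, ht2⟩, -⟩ := id hp
    have hx' : ‖x‖ < R := by simpa using hx
    exact key ht1 ht2 hx' (hrp _ hp) (hrr _ hp)
      (hDu _ hp.1 (r (x, t) / 2) (half_pos (hrp _ hp)) ((half_le_self (hrp _ hp).le).trans (hrr _ hp)))
      h3 hP hPn
  have hvol : ∀ p ∈ E, ENNReal.ofReal (η / 2 * r p ^ (n + 2)) ≤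
      volume ((Dr p.1 p.2 (r p) ∩ F) \ E) := by
    intro p hp
    have h0 := hrp p hp
    have hsub : Dr p.1 p.2 (r p) \ E ⊆
        (Dr p.1 p.2 (r p / 2) \ E) ∪ ((Dr p.1 p.2 (r p) ∩ F) \ E) := by
      rintro P ⟨h1, h2⟩
      by_cases h3 : P ∈ Dr p.1 p.2 (r p / 2)
      · exact Or.inl ⟨h3, h2⟩
      · exact Or.inr ⟨⟨h1, hmain p hp P h1 h3⟩, h2⟩
    have k1 : ENNReal.ofReal (η * r p ^ (n + 2)) ≤
        ENNReal.ofReal (η * (r p / 2) ^ (n + 2)) + volume ((Dr p.1 p.2 (r p) ∩ F) \ E) :=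
      (hr2 p hp).trans ((measure_mono hsub).trans ((measure_union_le _ _).trans
        (by gcongr; exact (hr3 p hp).le)))
    rw [← tsub_le_iff_left, ← ENNReal.ofReal_sub _ (by positivity)] at k1
    refine le_trans (ENNReal.ofReal_le_ofReal ?_) k1
    have : (r p / 2) ^ (n + 2) ≤ r p ^ (n + 2) / 2 := by
      rw [div_pow]
      gcongr
      calc (2 : ℝ) = 2 ^ 1 := by norm_num
        _ ≤ 2 ^ (n + 2) := by gcongr <;> norm_num
    nlinarith
  have hfin := vit (by positivity) E F hEo.measurableSet hFo.measurableSet r hrp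
    (fun p hp => (hrr p hp).trans hr1) hvol
  rw [← hω] at hfin
  have hfin2 : ENNReal.ofReal (η / 2 / (3 ^ n * 10 * ω.toReal)) * volume E ≤ volume (F \ E) := by
    have e1 : ENNReal.ofReal (3 ^ n * 10) * ω = ENNReal.ofReal (3 ^ n * 10 * ω.toReal) := by
      rw [ENNReal.ofReal_mul (p := 3 ^ n * 10) (q := ω.toReal) (by positivity), ENNReal.ofReal_toReal hωt]
    rw [e1] at hfin
    rw [ENNReal.ofReal_div_of_pos (by positivity), mul_comm, ← mul_div_assoc, mul_comm]
    exact ENNReal.div_le_of_le_mul' hfin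
  calc _ = volume E + ENNReal.ofReal (η / 2 / (3 ^ n * 10 * ω.toReal)) * volume E := by
        rw [ENNReal.ofReal_add (by norm_num) (by positivity)]; simp [add_mul]
    _ ≤ volume E + volume (F \ E) := by gcongr
    _ = volume F := by
        rw [add_comm]
        exact measure_sdiff_add_inter F hEo.measurableSet ▸ by rw [inter_eq_self_of_subset_right hEF]


set_option maxHeartbeats 800000 in
lemma core {n : ℕ} {a nb : ℝ} (ha : 0 < a) (hnb : 0 ≤ nb) :
    ∃ f0 c0 : ℝ, 0 < f0 ∧ 0 < c0 ∧ c0 < 1 ∧ ∀ (u : SpaceTime n → ℝ) (D : Set (SpaceTime n)) (f : ℝ),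
      ContinuousOn u D → SupT a nb 1 f u D → 0 ≤ f → f ≤ f0 →
      (∀ x t, ‖x‖ < 1 → -1 < t → t < 1 → (x, t) ∈ D ∧ 0 ≤ u (x, t)) →
      volume (ball 0 (1 / 32) ×ˢ Ioo (-7 / 8) (-7 / 8 + 1 / 32) : Set (SpaceTime n)) ≤
        2 * volume {P | P ∈ (ball 0 (1 / 32) ×ˢ Ioo (-7 / 8) (-7 / 8 + 1 / 32) : Set (SpaceTime n)) ∧
          1 / 3 < u P} →
      ∀ x t, ‖x‖ < 1 / 2 → -(1 / 4) < t → t < 1 / 4 → c0 ≤ u (x, t) := by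
  obtain ⟨η, hη, hloc⟩ := loc (n := n) ha hnb
  obtain ⟨σ, c, hσ, hc0, hc1, hstep⟩ := inkstep ha hη (hloc : LocP n a nb η)
  obtain ⟨N, hN⟩ := pow_unbounded_of_one_lt ((2 : ℝ) ^ (n + 2)) (by linarith : 1 < 1 + σ)
  have hN1 : 1 ≤ N := by
    by_contra h
    have : N = 0 := by omega
    rw [this, pow_zero] at hN
    have : (1 : ℝ) ≤ 2 ^ (n + 2) := one_le_pow₀ (by norm_num)
    linarith
  have hNr : (1 : ℝ) ≤ N := by exact_mod_cast hN1
  set r0 : ℝ := 1 / (32 * N) with hr0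
  have hr0p : 0 < r0 := by positivity
  have hNr0 : N * r0 = 1 / 32 := by rw [hr0]; field_simp
  have hr0' : r0 ≤ 1 / 32 := by nlinarith
  set m : ℝ := c ^ N / 9 with hm
  have hm0 : 0 < m := by positivity
  set α := alph a nb (3 / 4) with hα
  have hα0 : 0 ≤ α := alph_nonneg ha
  set q : ℝ := Real.exp (-(α / (r0 / 4) ^ 2 * (9 / 8))) with hq
  have hq0 : 0 < q := Real.exp_pos _
  have hq1 : q ≤ 1 := by
    have : 0 ≤ α / (r0 / 4) ^ 2 * (9 / 8) := by positivity
    exact Real.exp_le_one_iff.2 (by linarith)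
  have hcN : c ^ N ≤ 1 := pow_le_one₀ hc0.le hc1.le
  have hcNj : ∀ j, j ≤ N → c ^ N ≤ c ^ j := fun j hj => pow_le_pow_of_le_one hc0.le hc1.le hj
  refine ⟨min (c * (c ^ N / 3)) (m * q / 4), m * q / 2, by positivity, by positivity, ?_, ?_⟩
  · nlinarith
  intro u D f hc hS hf hf0 hD hvol
  have hf1 : f ≤ c * (c ^ N / 3) := hf0.trans (min_le_left _ _)
  have hf2 : f ≤ m * q / 4 := hf0.trans (min_le_right _ _)
  set R : ℕ → ℝ := fun j => 1 / 32 + j * r0 with hR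
  set S : ℕ → ℝ := fun j => -7 / 8 + 1 / 32 + j * r0 with hSS
  have hjr : ∀ j : ℕ, j ≤ N → (j : ℝ) * r0 ≤ 1 / 32 := by
    intro j hj
    have : (j : ℝ) ≤ N := by exact_mod_cast hj
    nlinarith
  have hgood : ∃ p : SpaceTime n, ‖p.1‖ < 1 / 16 ∧ -7 / 8 < p.2 ∧ p.2 < -7 / 8 + 1 / 16 ∧
      ∀ y, ‖y - p.1‖ ≤ r0 / 4 → m < u (y, p.2 + r0 ^ 2 / 2) := by
    by_contra hno
    have hind : ∀ j : ℕ, j ≤ N → ENNReal.ofReal ((1 + σ) ^ j) *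
        volume {P | P ∈ (ball 0 (R 0) ×ˢ Ioo (-7 / 8) (S 0) : Set (SpaceTime n)) ∧ c ^ 0 / 3 < u P} ≤
        volume {P | P ∈ (ball 0 (R j) ×ˢ Ioo (-7 / 8) (S j) : Set (SpaceTime n)) ∧
          c ^ j / 3 < u P} := by
      intro j
      induction j with
      | zero => intro _; rw [pow_zero, ENNReal.ofReal_one, one_mul]
      | succ j ih =>
        intro hj
        have hj1 := hjr j (by omega)
        have hj0 : 0 ≤ (j : ℝ) * r0 := by positivity
        have hcj := hcNj j (by omega)
        have hjj := ih (by omega)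
        rcases hstep u D f (c ^ j / 3) r0 (R j) (-7 / 8) (S j) hc hS hf (by positivity) hr0p
          (by linarith) (hf1.trans (by gcongr)) (by
            intro x t h1 h2 h3
            apply hD
            · simp only [hR] at h1; linarith
            · linarith
            · simp only [hSS] at h3; linarith) with ⟨p, hp, hpy⟩ | h
        · exfalso
          obtain ⟨hp1, hp2, hp3⟩ := hp
          have hp1' : ‖p.1‖ < R j := by simpa using hp1
          simp only [hR] at hp1'
          simp only [hSS] at hp3
          refine hno ⟨p, by linarith, hp2, by linarith, fun y hy => lt_of_le_of_lt ?_ (hpy y hy)⟩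
          rw [hm]
          linarith
        · have e1 : R j + r0 = R (j + 1) := by simp only [hR]; push_cast; ring
          have e2 : S j + r0 = S (j + 1) := by simp only [hSS]; push_cast; ring
          have e3 : c * (c ^ j / 3) = c ^ (j + 1) / 3 := by ring
          rw [e1, e2, e3] at h
          refine le_trans ?_ h
          rw [pow_succ, mul_comm ((1 + σ) ^ j), ENNReal.ofReal_mul (by positivity), mul_assoc]
          gcongr
    have h1 := hind N le_rfl
    have e1 : R 0 = 1 / 32 := by simp [hR]
    have e2 : S 0 = -7 / 8 + 1 / 32 := by simp [hSS]
    have e3 : c ^ 0 / 3 = 1 / 3 := by simp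
    have e4 : R N = 1 / 16 := by simp only [hR]; linarith
    have e5 : S N = -7 / 8 + 1 / 16 := by simp only [hSS]; linarith
    rw [e1, e2, e3, e4, e5] at h1
    set V := volume {P | P ∈ (ball 0 (1 / 32) ×ˢ Ioo (-7 / 8) (-7 / 8 + 1 / 32) : Set (SpaceTime n)) ∧
          1 / 3 < u P} with hV
    have h2 := h1.trans (measure_mono (t := ball 0 (1 / 16) ×ˢ Ioo (-7 / 8) (-7 / 8 + 1 / 16))
      (fun P hP => hP.1))
    rw [vol_obox _ _ _ (by norm_num)] at h2 hvol
    set ω := volume (ball (0 : Eucl n) 1) with hω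
    have hω0 : 0 < ω := measure_ball_pos _ _ one_pos
    have hωt : ω ≠ ⊤ := measure_ball_lt_top.ne
    set k : ENNReal := ENNReal.ofReal ((1 / 32) ^ n) * ω *
      ENNReal.ofReal (-7 / 8 + 1 / 32 - -7 / 8) with hk
    have hk0 : k ≠ 0 := by
      refine mul_ne_zero (mul_ne_zero ?_ hω0.ne') ?_
      · rw [Ne, ENNReal.ofReal_eq_zero, not_le]; positivity
      · rw [Ne, ENNReal.ofReal_eq_zero, not_le]; norm_num
    have hkt : k ≠ ⊤ := ENNReal.mul_ne_top (ENNReal.mul_ne_top ENNReal.ofReal_ne_top hωt)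
      ENNReal.ofReal_ne_top
    have e6 : ENNReal.ofReal ((1 / 16) ^ n) * ω * ENNReal.ofReal (-7 / 8 + 1 / 16 - -7 / 8) =
        ENNReal.ofReal (2 ^ (n + 1)) * k := by
      rw [hk]
      calc _ = ω * (ENNReal.ofReal ((1 / 16) ^ n) * ENNReal.ofReal (-7 / 8 + 1 / 16 - -7 / 8)) := by
            ring
        _ = ω * (ENNReal.ofReal (2 ^ (n + 1)) * ENNReal.ofReal ((1 / 32) ^ n) *
              ENNReal.ofReal (-7 / 8 + 1 / 32 - -7 / 8)) := by
            rw [← ENNReal.ofReal_mul (by positivity), ← ENNReal.ofReal_mul (by positivity),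
              ← ENNReal.ofReal_mul (by positivity)]
            congr 2
            rw [show (1 / 16 : ℝ) = 2 * (1 / 32) by norm_num, mul_pow]
            ring
        _ = _ := by ring
    rw [e6] at h2
    have h3 : ENNReal.ofReal ((1 + σ) ^ N) * k ≤ ENNReal.ofReal (2 ^ (n + 2)) * k := by
      calc _ ≤ ENNReal.ofReal ((1 + σ) ^ N) * (2 * V) := by gcongr
        _ = 2 * (ENNReal.ofReal ((1 + σ) ^ N) * V) := by ring
        _ ≤ 2 * (ENNReal.ofReal (2 ^ (n + 1)) * k) := by gcongr
        _ = _ := by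
          rw [pow_succ _ (n + 1), mul_comm ((2 : ℝ) ^ (n + 1)) 2, ENNReal.ofReal_mul (by norm_num)]
          simp [mul_assoc]
    rw [ENNReal.mul_le_mul_iff_left hk0 hkt, ENNReal.ofReal_le_ofReal_iff (by positivity)] at h3
    linarith
  obtain ⟨⟨x0, t0⟩, hx0, ht1, ht2, hy⟩ := hgood
  simp only at hx0 ht1 ht2 hy
  intro x t hx htl htu
  have hr2 : r0 ^ 2 ≤ 1 / 1024 := by nlinarith
  have hr2p : 0 < r0 ^ 2 := by positivity
  set s := t0 + r0 ^ 2 / 2 with hs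
  have hxx : ‖x - x0‖ ^ 2 ≤ 81 / 256 := by
    have : ‖x - x0‖ ≤ 9 / 16 := by
      have := norm_sub_le x x0
      linarith
    nlinarith [norm_nonneg (x - x0)]
  have hsp := spread hS hc ha hf (z := x0) (s := s) (ρ := r0 / 4) (κ := 3 / 4)
    (T := 1 / 4 - s) (m := m) (by positivity) (by norm_num) hm0.le (by
      intro x' t' h1 h2 h3
      apply hD
      · have h4 : ‖x' - x0‖ ^ 2 < (15 / 16) ^ 2 := by
          have : (3 / 4) * (t' - s) ≤ 3 / 4 * (9 / 8) := by linarith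
          nlinarith
        have h5 := lt_of_pow_lt_pow_left₀ 2 (by positivity) h4
        have := norm_le_norm_add_norm_sub' x' x0
        linarith
      · linarith
      · linarith) (fun x' h1 => (hy x' h1).le) x t (by linarith) (by linarith) (by nlinarith)
  rw [← hα] at hsp
  have hw : 1 ≤ (((r0 / 4) ^ 2 + 3 / 4 * (t - s) - ‖x - x0‖ ^ 2) / (r0 / 4) ^ 2) ^ 2 := by
    apply one_le_pow₀
    rw [one_le_div (by positivity)]
    linarith
  have hexp : q ≤ Real.exp (-(α / (r0 / 4) ^ 2 * (t - s))) := by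
    apply Real.exp_le_exp.2
    have : α / (r0 / 4) ^ 2 * (t - s) ≤ α / (r0 / 4) ^ 2 * (9 / 8) := by
      gcongr
      linarith
    linarith
  have h7 : m * q * 1 ≤ m * Real.exp (-(α / (r0 / 4) ^ 2 * (t - s))) *
        (((r0 / 4) ^ 2 + 3 / 4 * (t - s) - ‖x - x0‖ ^ 2) / (r0 / 4) ^ 2) ^ 2 := by gcongr
  have h8 : f * (t - s) ≤ f * 2 := by
    gcongr
    linarith
  linarith


lemma cyl_open {n : ℕ} (lam : ℝ) (x₀ : Eucl n) (t₀ r : ℝ) : IsOpen (cylCLam lam x₀ t₀ r) :=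
  isOpen_ball.prod isOpen_Ioo

/-- **Interior Harnack dichotomy.** There are constants `C > 0` and `c₀ ∈ (0,1)`,
depending only on `n, Λ, M`, such that any viscosity solution `θ` of
`λθ_t ≤ P⁺_{Λ,M}(D²θ) + δ`, `λθ_t ≥ P⁻_{Λ,M}(D²θ) − δ` in `C_r^λ(x₀,t₀)` with
`ϱ ≤ θ ≤ ϱ + μ`, `μ ≥ Cδr²`, satisfies on `C_{r/2}^λ(x₀,t₀)`: either `ϱ + c₀μ ≤ θ ≤ ϱ + μ`
or `ϱ ≤ θ ≤ ϱ + (1−c₀)μ`. -/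
theorem interior_harnack_dichotomy {n : ℕ} (hn : 1 ≤ n) (Λ M : ℝ) (hΛ : 1 ≤ Λ) (hM : 1 ≤ M) :
    ∃ C c₀ : ℝ, 0 < C ∧ 0 < c₀ ∧ c₀ < 1 ∧
      ∀ (lam r δ : ℝ) (x₀ : Eucl n) (t₀ : ℝ) (θ : SpaceTime n → ℝ) (ϱ μ : ℝ),
        0 < lam → lam ≤ 1 → 0 < r → 0 ≤ δ →
        ContinuousOn θ (cylCLam lam x₀ t₀ r) →
        ViscSubLam lam (fun H => pucciPlus H (1 / (n * Λ * M ^ 2)) (Λ * M ^ 2) + δ) θ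
          (cylCLam lam x₀ t₀ r) →
        ViscSupLam lam (fun H => pucciMinus H (1 / (n * Λ * M ^ 2)) (Λ * M ^ 2) - δ) θ
          (cylCLam lam x₀ t₀ r) →
        C * δ * r ^ 2 ≤ μ →
        (∀ p ∈ cylCLam lam x₀ t₀ r, ϱ ≤ θ p ∧ θ p ≤ ϱ + μ) →
        ((∀ p ∈ cylCLam lam x₀ t₀ (r / 2), ϱ + c₀ * μ ≤ θ p ∧ θ p ≤ ϱ + μ) ∨
         (∀ p ∈ cylCLam lam x₀ t₀ (r / 2), ϱ ≤ θ p ∧ θ p ≤ ϱ + (1 - c₀) * μ)) := by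
  have hn' : (1 : ℝ) ≤ n := by exact_mod_cast hn
  have hM2 : 1 ≤ M ^ 2 := one_le_pow₀ hM
  have hΛM : 1 ≤ Λ * M ^ 2 := by nlinarith
  have hnΛM : 1 ≤ n * Λ * M ^ 2 := by rw [mul_assoc]; nlinarith
  set a : ℝ := 1 / (n * Λ * M ^ 2) with ha
  set b : ℝ := Λ * M ^ 2 with hb
  have ha0 : 0 < a := by positivity
  have hab : a ≤ b := le_trans (by rw [ha]; exact (div_le_one (by linarith)).2 hnΛM) hΛM
  obtain ⟨f0, c0, hf0, hc0, hc1, hcore⟩ := core (n := n) (nb := n * b) ha0 (by positivity)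
  refine ⟨1 / f0, c0, by positivity, hc0, hc1, ?_⟩
  intro lam r δ x₀ t₀ θ ϱ μ hlam hlam1 hr hδ hθ hsub hsup hCμ hbd
  have hμ0 : 0 ≤ μ := le_trans (by positivity) hCμ
  have hsubset : cylCLam lam x₀ t₀ (r / 2) ⊆ cylCLam lam x₀ t₀ r := by
    have hl : lam * (r / 2) ^ 2 ≤ lam * r ^ 2 := by
      gcongr; linarith
    rintro ⟨x, t⟩ ⟨h1, h2, h3⟩
    exact ⟨ball_subset_ball (by linarith) h1, by simp only at h2 ⊢; linarith,
      by simp only at h3 ⊢; linarith⟩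
  rcases hμ0.eq_or_lt with hμ | hμ
  · left
    intro p hp
    have := hbd p (hsubset hp)
    rw [← hμ] at this ⊢
    constructor <;> linarith
  have hrl : 0 < lam * r ^ 2 := by positivity
  set φ : SpaceTime n → SpaceTime n := fun P => (x₀ + r • P.1, t₀ + lam * r ^ 2 * P.2) with hφ
  have hφc : Continuous φ := by fun_prop
  set D := φ ⁻¹' cylCLam lam x₀ t₀ r with hD
  have hDmem : ∀ x t, ‖x‖ < 1 → -1 < t → t < 1 → (x, t) ∈ D := by
    intro x t h1 h2 h3
    refine ⟨?_, ?_, ?_⟩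
    · simp only [hφ, mem_ball, dist_eq_norm, add_sub_cancel_left, norm_smul,
        Real.norm_of_nonneg hr.le]
      nlinarith
    · simp only [hφ]; nlinarith
    · simp only [hφ]; nlinarith
  have hsur : ∀ p ∈ cylCLam lam x₀ t₀ (r / 2), ∃ x t, ‖x‖ < 1 / 2 ∧ -(1 / 4) < t ∧ t < 1 / 4 ∧
      φ (x, t) = p := by
    rintro ⟨x, t⟩ ⟨h1, h2, h3⟩
    refine ⟨(1 / r) • (x - x₀), (t - t₀) / (lam * r ^ 2), ?_, ?_, ?_, ?_⟩
    · rw [mem_ball, dist_eq_norm] at h1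
      simp only at h1
      rw [norm_smul, Real.norm_of_nonneg (by positivity), one_div_mul_eq_div, div_lt_iff₀ hr]
      linarith
    · simp only at h2
      rw [lt_div_iff₀ hrl]; linarith
    · simp only at h3
      rw [div_lt_iff₀ hrl]; linarith
    · simp only [hφ, smul_smul, Prod.mk.injEq]
      constructor
      · rw [mul_one_div_cancel hr.ne', one_smul]; abel
      · field_simp; ring
  set f := δ * r ^ 2 / μ with hf
  have hf00 : 0 ≤ f := by positivity
  have hff : f ≤ f0 := by
    rw [hf, div_le_iff₀ hμ]
    have : 1 / f0 * δ * r ^ 2 = (δ * r ^ 2) / f0 := by ring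
    rw [this, div_le_iff₀ hf0] at hCμ
    linarith
  set u1 : SpaceTime n → ℝ := fun P => (θ (φ P) - ϱ) / μ with hu1
  set u2 : SpaceTime n → ℝ := fun P => (-θ (φ P) - (-(ϱ + μ))) / μ with hu2
  have hS1 : SupT a (n * b) 1 f u1 D :=
    (SupT_of_visc ha0 hab (cyl_open _ _ _ _) hsup).scale x₀ t₀ ϱ hlam hr hμ
  have hS2 : SupT a (n * b) 1 f u2 D :=
    (SupT_of_visc_neg ha0 hab (cyl_open _ _ _ _) hsub).scale x₀ t₀ (-(ϱ + μ)) hlam hr hμ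
  have hθc : ContinuousOn (fun P => θ (φ P)) D := hθ.comp hφc.continuousOn (mapsTo_preimage _ _)
  have hc1' : ContinuousOn u1 D := (hθc.sub continuousOn_const).div_const _
  have hc2' : ContinuousOn u2 D := (hθc.neg.sub continuousOn_const).div_const _
  have hp1 : ∀ P ∈ D, 0 ≤ u1 P := fun P hP => by
    have := hbd _ hP
    exact div_nonneg (by linarith) hμ.le
  have hp2 : ∀ P ∈ D, 0 ≤ u2 P := fun P hP => by
    have := hbd _ hP
    exact div_nonneg (by linarith) hμ.le
  set K : Set (SpaceTime n) := ball 0 (1 / 32) ×ˢ Ioo (-7 / 8) (-7 / 8 + 1 / 32) with hK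
  have hsum : ∀ P, u1 P + u2 P = 1 := by
    intro P
    simp only [hu1, hu2]
    field_simp
    ring
  have hcov : K ⊆ {P | P ∈ K ∧ 1 / 3 < u1 P} ∪ {P | P ∈ K ∧ 1 / 3 < u2 P} := by
    intro P hP
    by_cases h : 1 / 3 < u1 P
    · exact Or.inl ⟨hP, h⟩
    · exact Or.inr ⟨hP, by have := hsum P; linarith⟩
  have hv := (measure_mono hcov).trans (measure_union_le (μ := volume) _ _)
  rcases le_total (volume {P | P ∈ K ∧ 1 / 3 < u2 P}) (volume {P | P ∈ K ∧ 1 / 3 < u1 P}) with h | h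
  · left
    have key := hcore u1 D f hc1' hS1 hf00 hff
      (fun x t h1 h2 h3 => ⟨hDmem x t h1 h2 h3, hp1 _ (hDmem x t h1 h2 h3)⟩)
      (hv.trans (by rw [two_mul]; gcongr))
    intro p hp
    refine ⟨?_, (hbd p (hsubset hp)).2⟩
    obtain ⟨x, t, h1, h2, h3, rfl⟩ := hsur p hp
    have := key x t h1 h2 h3
    simp only [hu1] at this
    rw [le_div_iff₀ hμ] at this
    linarith
  · right
    have key := hcore u2 D f hc2' hS2 hf00 hff
      (fun x t h1 h2 h3 => ⟨hDmem x t h1 h2 h3, hp2 _ (hDmem x t h1 h2 h3)⟩)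
      (hv.trans (by rw [two_mul]; gcongr))
    intro p hp
    refine ⟨(hbd p (hsubset hp)).1, ?_⟩
    obtain ⟨x, t, h1, h2, h3, rfl⟩ := hsur p hp
    have := key x t h1 h2 h3
    simp only [hu2] at this
    rw [le_div_iff₀ hμ] at this
    linarith
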